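/- arXiv:1505.06157 — 5 statements merged into one kernel-verified Lean document; each statement's English description precedes it below -/
import Mathlib

section
/- Let α > 0, let n be an integer with |n| ≥ 1, let κ ∈ ℝ and R > 0. If u is a classical solution of the n-vortex equation which has finite energy and is not identically zero on [0,R], then the wave propagation constant satisfies κ < α⁻¹ − (r₀² + n²)/(2R²). -/
open MeasureTheory Set Filter

noncomputable section

/-- The Bessel function `J₀`. -/
def besselJ0 (x : ℝ) : ℝ :=
  ∑' m : ℕ, (-1 : ℝ) ^ m * (x / 2) ^ (2 * m) / ((Nat.factorial m : ℝ)) ^ 2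

/-- The smallest positive zero of `J₀` (≈ 2.404826). -/
def besselR0 : ℝ := sInf {x : ℝ | 0 < x ∧ besselJ0 x = 0}

/-- `u` is a classical solution of the `n`-vortex equation with parameters `(α, n, κ, R)`. -/
def IsVortexSol (α : ℝ) (n : ℤ) (κ R : ℝ) (u : ℝ → ℝ) : Prop :=
  ContinuousOn u (Icc 0 R) ∧
  (∀ r ∈ Ioo (0 : ℝ) R, DifferentiableAt ℝ u r ∧ DifferentiableAt ℝ (deriv u) r) ∧
  u 0 = 0 ∧ u R = 0 ∧
  ∀ r ∈ Ioo (0 : ℝ) R,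
    deriv (fun s => s * deriv u s) r - ((n : ℝ) ^ 2 / r) * u r
      + 2 * r * (u r) ^ 3 / (1 + α * (u r) ^ 2) - 2 * κ * r * u r = 0

/-- `u` has finite energy. -/
def FiniteEnergy (α R : ℝ) (u : ℝ → ℝ) : Prop :=
  IntegrableOn
    (fun r => r * (deriv u r) ^ 2 + (u r) ^ 2 / r + r * Real.log (1 + α * (u r) ^ 2))
    (Ioo 0 R)

/-- The energy flux `Q(u) = 2π ∫₀^R r u(r)² dr`. -/
def fluxQ (R : ℝ) (u : ℝ → ℝ) : ℝ := 2 * Real.pi * ∫ r in Ioo (0 : ℝ) R, r * (u r) ^ 2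

/-- The tent function with parameters `a` and `b`. -/
def tent (a b : ℝ) : ℝ → ℝ := fun r => if r ≤ a then (b / a) * r else (b / a) * (2 * a - r)

/-- The action functional `I_κ`. -/
def actI (α : ℝ) (n : ℤ) (κ R : ℝ) (u : ℝ → ℝ) : ℝ :=
  (1 / 2) * ∫ r in Ioo (0 : ℝ) R,
    (r * (deriv u r) ^ 2 + ((n : ℝ) ^ 2 / r) * (u r) ^ 2
      - 2 * (α⁻¹ - κ) * r * (u r) ^ 2 + 2 * (α ^ 2)⁻¹ * r * Real.log (1 + α * (u r) ^ 2))

/-- The action functional `𝓘`. -/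
def actI0 (α : ℝ) (n : ℤ) (R : ℝ) (u : ℝ → ℝ) : ℝ :=
  (1 / 2) * ∫ r in Ioo (0 : ℝ) R,
    (r * (deriv u r) ^ 2 + ((n : ℝ) ^ 2 / r) * (u r) ^ 2
      - 2 * α⁻¹ * r * (u r) ^ 2 + 2 * (α ^ 2)⁻¹ * r * Real.log (1 + α * (u r) ^ 2))

/-- The functional `γ_κ`. -/
def gammaK (α : ℝ) (n : ℤ) (κ R : ℝ) (u : ℝ → ℝ) : ℝ :=
  (1 / 2) * ∫ r in Ioo (0 : ℝ) R,
    (r * (deriv u r) ^ 2 + ((n : ℝ) ^ 2 / r) * (u r) ^ 2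
      - 2 * (α⁻¹ - κ) * r * (u r) ^ 2 + 2 * α⁻¹ * r * (u r) ^ 2 / (1 + α * (u r) ^ 2))

/-- Membership in the class `X`. -/
def MemX (R : ℝ) (u : ℝ → ℝ) : Prop :=
  ContinuousOn u (Icc 0 R) ∧ ContDiffOn ℝ 1 u (Ioo 0 R) ∧ u 0 = 0 ∧ u R = 0 ∧
    IntegrableOn (fun r => r * (deriv u r) ^ 2 + (u r) ^ 2 / r) (Ioo 0 R)

/-- Membership in the class `X`, allowing finitely many exceptional points. -/
def MemX' (R : ℝ) (u : ℝ → ℝ) : Prop :=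
  ContinuousOn u (Icc 0 R) ∧ (∃ S : Finset ℝ, ContDiffOn ℝ 1 u (Ioo 0 R \ ↑S)) ∧
    u 0 = 0 ∧ u R = 0 ∧
    IntegrableOn (fun r => r * (deriv u r) ^ 2 + (u r) ^ 2 / r) (Ioo 0 R)

/-- The admissible class `𝒜`. -/
def Admissible (α R : ℝ) (v : ℝ → ℝ) : Prop :=
  (∃ K : NNReal, LipschitzOnWith K v (Icc 0 R)) ∧ v 0 = 0 ∧ v R = 0 ∧ FiniteEnergy α R v

end

lemma aux_congr {f g : ℝ → ℝ} {f' g' x : ℝ} (h : HasDerivAt f f' x) (hf : ∀ s, g s = f s)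
    (hg : g' = f') : HasDerivAt g g' x := by
  obtain rfl : g = f := funext hf
  rw [hg]; exact h

/-- Entire power series with factorially decaying coefficients: termwise derivative. -/
lemma aux_series_deriv (c : ℕ → ℝ) (hc : ∀ m, |c m| ≤ 1 / (m.factorial : ℝ)) (y : ℝ) :
    HasDerivAt (fun y => ∑' m : ℕ, c m * y ^ m) (∑' m : ℕ, c (m + 1) * (m + 1) * y ^ m) y := by
  set B : ℝ := |y| + 1 with hB
  have hBpos : 0 < B := by positivity
  have hs : Summable (fun m : ℕ => B ^ (m - 1) / ((m - 1).factorial : ℝ)) := by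
    rw [← summable_nat_add_iff 1]
    simpa using Real.summable_pow_div_factorial B
  have key : HasDerivAt (fun y => ∑' m : ℕ, c m * y ^ m)
      (∑' m : ℕ, c m * (m * y ^ (m - 1))) y := by
    refine hasDerivAt_tsum_of_isPreconnected (t := Ioo (-B) B) (y₀ := 0)
      (g := fun m y => c m * y ^ m) (g' := fun m y => c m * (m * y ^ (m - 1)))
      hs isOpen_Ioo isPreconnected_Ioo ?_ ?_ ?_ ?_ ?_
    · intro m x _
      exact (hasDerivAt_pow m x).const_mul (c m)
    · intro m x hx
      have hx' : |x| ≤ B := (abs_lt.2 hx).le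
      rcases m with _ | m
      · simp
      · simp only [Nat.add_sub_cancel, Real.norm_eq_abs, abs_mul, abs_pow]
        have h1 := hc (m + 1)
        have h2 : |c (m + 1)| * |((m + 1 : ℕ) : ℝ)| ≤ 1 / (m.factorial : ℝ) := by
          rw [abs_of_nonneg (by positivity : (0:ℝ) ≤ ((m + 1 : ℕ) : ℝ))]
          calc _ ≤ 1 / ((m + 1).factorial : ℝ) * ((m + 1 : ℕ) : ℝ) := by gcongr
            _ = 1 / (m.factorial : ℝ) := by
              rw [Nat.factorial_succ]; push_cast; field_simp
        calc |c (m + 1)| * (|((m + 1 : ℕ) : ℝ)| * |x| ^ m)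
            = (|c (m + 1)| * |((m + 1 : ℕ) : ℝ)|) * |x| ^ m := by ring
          _ ≤ 1 / (m.factorial : ℝ) * B ^ m := by gcongr
          _ = B ^ m / (m.factorial : ℝ) := by ring
    · simp [hBpos]
    · refine summable_of_ne_finset_zero (s := {0}) ?_
      intro m hm
      have : m ≠ 0 := by simpa using hm
      simp [this]
    · rw [mem_Ioo, ← abs_lt]; linarith
  have e : (∑' m : ℕ, c m * (m * y ^ (m - 1))) = ∑' m : ℕ, c (m + 1) * (m + 1) * y ^ m := by
    have hs2 : Summable (fun m : ℕ => c m * (m * y ^ (m - 1))) := by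
      refine Summable.of_norm_bounded hs ?_
      intro m
      have hx' : |y| ≤ B := by linarith
      rcases m with _ | m
      · simp
      · simp only [Nat.add_sub_cancel, Real.norm_eq_abs, abs_mul, abs_pow]
        have h1 := hc (m + 1)
        have h2 : |c (m + 1)| * |((m + 1 : ℕ) : ℝ)| ≤ 1 / (m.factorial : ℝ) := by
          rw [abs_of_nonneg (by positivity : (0:ℝ) ≤ ((m + 1 : ℕ) : ℝ))]
          calc _ ≤ 1 / ((m + 1).factorial : ℝ) * ((m + 1 : ℕ) : ℝ) := by gcongr
            _ = 1 / (m.factorial : ℝ) := by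
              rw [Nat.factorial_succ]; push_cast; field_simp
        calc |c (m + 1)| * (|((m + 1 : ℕ) : ℝ)| * |y| ^ m)
            = (|c (m + 1)| * |((m + 1 : ℕ) : ℝ)|) * |y| ^ m := by ring
          _ ≤ 1 / (m.factorial : ℝ) * B ^ m := by gcongr
          _ = B ^ m / (m.factorial : ℝ) := by ring
    rw [hs2.tsum_eq_zero_add]
    simp only [Nat.cast_zero, zero_mul, mul_zero, zero_add, Nat.add_sub_cancel]
    refine tsum_congr fun m => ?_
    push_cast; ring
  rw [← e]; exact key

/-- Coefficients of `J₀` in the variable `x²/4`. -/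
noncomputable def auxC (m : ℕ) : ℝ := (-1 : ℝ) ^ m / (m.factorial : ℝ) ^ 2

lemma auxC_le (m : ℕ) : |auxC m| ≤ 1 / (m.factorial : ℝ) := by
  have h : (1:ℝ) ≤ m.factorial := by exact_mod_cast Nat.succ_le_of_lt m.factorial_pos
  simp only [auxC, abs_div, abs_pow, abs_neg, abs_one, one_pow]
  rw [abs_of_nonneg (by linarith)]
  apply one_div_le_one_div_of_le <;> nlinarith

lemma auxC_succ (m : ℕ) : auxC (m + 1) * (m + 1) * (m + 1) = - auxC m := by
  simp only [auxC, Nat.factorial_succ]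
  push_cast
  field_simp
  ring

lemma auxC_succ_le (m : ℕ) : |auxC (m + 1) * (m + 1)| ≤ 1 / (m.factorial : ℝ) := by
  have h := auxC_succ m
  have h1 := auxC_le m
  have h2 : |auxC (m + 1) * (m + 1)| * (m + 1) = |auxC m| := by
    rw [← abs_neg (auxC m), ← h, abs_mul (auxC (m + 1) * (m + 1)) ((m : ℝ) + 1),
      abs_of_nonneg (by positivity : (0:ℝ) ≤ (m:ℝ) + 1)]
  have : 0 ≤ |auxC (m + 1) * (m + 1)| * m := by positivity
  nlinarith

lemma auxD_le (m : ℕ) : |auxC m * m| ≤ 1 / (m.factorial : ℝ) := by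
  rcases m with _ | m
  · simp
  · simp only [auxC, abs_mul, abs_div, abs_pow, abs_neg, abs_one, one_pow, Nat.abs_cast]
    have h : (1:ℝ) ≤ m.factorial := by exact_mod_cast Nat.succ_le_of_lt m.factorial_pos
    rw [Nat.factorial_succ]; push_cast
    rw [div_mul_eq_mul_div, div_le_div_iff₀ (by positivity) (by positivity)]
    have h0 : (0:ℝ) ≤ ((m:ℝ) + 1) ^ 2 * m.factorial := by positivity
    nlinarith

/-- `J₀` as a function of `x²/4`. -/
noncomputable def auxF (y : ℝ) : ℝ := ∑' m : ℕ, auxC m * y ^ m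
/-- Derivative of `auxF`. -/
noncomputable def auxF' (y : ℝ) : ℝ := ∑' m : ℕ, auxC (m + 1) * (m + 1) * y ^ m

lemma auxF_deriv (y : ℝ) : HasDerivAt auxF (auxF' y) y := aux_series_deriv auxC auxC_le y

lemma auxF'_cont : Continuous auxF' :=
  continuous_iff_continuousAt.2 fun y =>
    (aux_series_deriv (fun m => auxC (m + 1) * (m + 1)) auxC_succ_le y).continuousAt

lemma aux_yF' (y : ℝ) : y * auxF' y = ∑' m : ℕ, auxC m * m * y ^ m := by
  have hs : Summable (fun m : ℕ => auxC m * m * y ^ m) := by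
    refine Summable.of_norm_bounded (Real.summable_pow_div_factorial |y|) ?_
    intro m
    rw [Real.norm_eq_abs, abs_mul, abs_pow]
    calc _ ≤ 1 / (m.factorial : ℝ) * |y| ^ m := by gcongr; exact auxD_le m
      _ = _ := by ring
  rw [hs.tsum_eq_zero_add, auxF', ← tsum_mul_left]
  simp only [Nat.cast_zero, mul_zero, zero_mul, zero_add]
  refine tsum_congr fun m => ?_
  push_cast; ring

lemma aux_yF'_deriv (y : ℝ) : HasDerivAt (fun y => y * auxF' y) (- auxF y) y := by
  have h := aux_series_deriv (fun m => auxC m * m) auxD_le y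
  have e : (fun y => y * auxF' y) = fun y => ∑' m : ℕ, auxC m * m * y ^ m := funext aux_yF'
  rw [e]
  convert h using 1
  rw [auxF, ← tsum_neg]
  refine tsum_congr fun m => ?_
  have := auxC_succ m
  push_cast
  rw [this]; ring

lemma besselJ0_eq (x : ℝ) : besselJ0 x = auxF (x ^ 2 / 4) := by
  unfold besselJ0 auxF auxC
  refine tsum_congr fun m => ?_
  have : x ^ 2 / 4 = (x / 2) ^ 2 := by ring
  rw [this, ← pow_mul]; ring

lemma besselJ0_zero : besselJ0 0 = 1 := by
  rw [besselJ0_eq, auxF, tsum_eq_single 0]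
  · simp [auxC]
  · intro m hm; simp [hm]

lemma besselJ0_cont : Continuous besselJ0 := by
  have : besselJ0 = fun x => auxF (x ^ 2 / 4) := funext besselJ0_eq
  rw [this]
  have h : Continuous auxF := continuous_iff_continuousAt.2 fun y => (auxF_deriv y).continuousAt
  exact h.comp (by fun_prop)

lemma besselR0_nonneg : 0 ≤ besselR0 := Real.sInf_nonneg fun _ hx => hx.1.le

lemma besselJ0_pos {x : ℝ} (hx : 0 ≤ x) (hx' : x < besselR0 ∨ x = 0) : 0 < besselJ0 x := by
  rcases hx' with h | h
  · by_contra hneg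
    push Not at hneg
    obtain ⟨t, ht, h0⟩ := intermediate_value_Icc' hx besselJ0_cont.continuousOn
      (show (0:ℝ) ∈ Icc (besselJ0 x) (besselJ0 0) from ⟨hneg, by simp [besselJ0_zero]⟩)
    have ht0 : 0 < t := by
      rcases ht.1.eq_or_lt with h1 | h1
      · rw [← h1, besselJ0_zero] at h0; norm_num at h0
      · exact h1
    have : besselR0 ≤ t := csInf_le ⟨0, fun _ hx => hx.1.le⟩ ⟨ht0, h0⟩
    linarith [ht.2]
  · rw [h, besselJ0_zero]; norm_num

 
lemma aux_core (R l : ℝ) (u du v dv q : ℝ → ℝ) (x0 : ℝ) (hx0 : x0 ∈ Ioo 0 R)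
    (hu : ContinuousOn u (Icc 0 R)) (hu0 : u 0 = 0) (huR : u R = 0)
    (hd : ∀ r ∈ Ioo 0 R, HasDerivAt u (du r) r)
    (hdd : ∀ r ∈ Ioo 0 R, HasDerivAt (fun s => s * du s) (r * q r * u r) r)
    (hq : ∀ r ∈ Ioo 0 R, -l < q r)
    (hv : ∀ r, HasDerivAt v (dv r) r) (hdv : Continuous dv)
    (hvv : ∀ r, HasDerivAt (fun s => s * dv s) (-(l * r * v r)) r)
    (hvpos : ∀ r ∈ Ico 0 R, 0 < v r) (hpos : 0 < u x0) : False := by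
  obtain ⟨hx0a, hx0b⟩ := hx0
  have hIL : Icc 0 x0 ⊆ Icc 0 R := Icc_subset_Icc_right hx0b.le
  have hIR : Icc x0 R ⊆ Icc 0 R := Icc_subset_Icc_left hx0a.le
  have hcL : IsCompact (Icc 0 x0 ∩ u ⁻¹' {0}) :=
    isCompact_Icc.of_isClosed_subset
      ((hu.mono hIL).preimage_isClosed_of_isClosed isClosed_Icc isClosed_singleton) inter_subset_left
  have hcR : IsCompact (Icc x0 R ∩ u ⁻¹' {0}) :=
    isCompact_Icc.of_isClosed_subset
      ((hu.mono hIR).preimage_isClosed_of_isClosed isClosed_Icc isClosed_singleton) inter_subset_left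
  obtain ⟨a, ⟨⟨ha0, hax⟩, hua⟩, hamax⟩ := hcL.exists_isGreatest ⟨0, ⟨le_rfl, hx0a.le⟩, hu0⟩
  obtain ⟨b, ⟨⟨hxb, hbR⟩, hub⟩, hbmin⟩ := hcR.exists_isLeast ⟨R, ⟨hx0b.le, le_rfl⟩, huR⟩
  replace hua : u a = 0 := hua
  replace hub : u b = 0 := hub
  have hax : a < x0 := lt_of_le_of_ne hax (by rintro rfl; linarith)
  have hxb : x0 < b := lt_of_le_of_ne hxb (by rintro rfl; linarith)
  have hupos : ∀ t ∈ Ioo a b, 0 < u t := by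
    intro t ht
    by_contra hneg
    push Not at hneg
    rcases le_total t x0 with h | h
    · obtain ⟨s, hs, hs0⟩ := intermediate_value_Icc h
        (hu.mono (Icc_subset_Icc (ha0.trans ht.1.le) hx0b.le)) (show (0:ℝ) ∈ Icc (u t) (u x0) from ⟨hneg, hpos.le⟩)
      have := hamax ⟨⟨by linarith [hs.1, ht.1], hs.2⟩, hs0⟩
      linarith [hs.1, ht.1]
    · obtain ⟨s, hs, hs0⟩ := intermediate_value_Icc' h
        (hu.mono (Icc_subset_Icc hx0a.le (ht.2.le.trans hbR))) (show (0:ℝ) ∈ Icc (u t) (u x0) from ⟨hneg, hpos.le⟩)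
      have := hbmin ⟨⟨hs.1, by linarith [hs.2, ht.2]⟩, hs0⟩
      linarith [hs.2, ht.2]
  have hsub : ∀ t ∈ Ioo a b, t ∈ Ioo 0 R := fun t ht => ⟨ha0.trans_lt ht.1, ht.2.trans_le hbR⟩
  have hvp : ∀ t ∈ Ico a b, 0 < v t := fun t ht => hvpos t ⟨ha0.trans ht.1, ht.2.trans_le hbR⟩
  set W : ℝ → ℝ := fun r => v r * (r * du r) - u r * (r * dv r) with hW
  have hWd : ∀ r ∈ Ioo a b, HasDerivAt W (r * u r * v r * (q r + l)) r := by
    intro r hr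
    have := ((hv r).mul (hdd r (hsub r hr))).sub ((hd r (hsub r hr)).mul (hvv r))
    refine aux_congr this (fun s => rfl) ?_
    ring
  have hWmono : StrictMonoOn W (Ioo a b) := by
    refine strictMonoOn_of_deriv_pos (convex_Ioo a b)
      (fun r hr => (hWd r hr).continuousAt.continuousWithinAt) ?_
    intro r hr
    rw [interior_Ioo] at hr
    rw [(hWd r hr).deriv]
    have h1 := hupos r hr
    have h2 := hvp r ⟨hr.1.le, hr.2⟩
    have h3 := (hsub r hr).1
    have h4 : 0 < q r + l := by linarith [hq r (hsub r hr)]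
    positivity
  have hgd : ∀ e : ℝ, ∀ r ∈ Ioo a b,
      HasDerivAt (fun s => (u s - e) / v s) ((W r / r + e * dv r) / v r ^ 2) r := by
    intro e r hr
    have h2 := hvp r ⟨hr.1.le, hr.2⟩
    have h3 := (hsub r hr).1
    have := ((hd r (hsub r hr)).sub_const e).div (hv r) h2.ne'
    refine aux_congr this (fun s => rfl) ?_
    simp only [hW]; field_simp; ring
  have hvc : Continuous v := continuous_iff_continuousAt.2 fun r => (hv r).continuousAt
  have hgc : ∀ e c d : ℝ, a ≤ c → d < b → ContinuousOn (fun s => (u s - e) / v s) (Icc c d) := by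
    intro e c d hc hdb
    refine ContinuousOn.div ((hu.mono (Icc_subset_Icc (ha0.trans hc) (hdb.le.trans hbR))).sub
      continuousOn_const) hvc.continuousOn ?_
    intro r hr
    exact (hvp r ⟨hc.trans hr.1, hr.2.trans_lt hdb⟩).ne'
  have hWx : 0 < W x0 := by
    by_contra hneg
    push Not at hneg
    have : StrictAntiOn (fun s => (u s - 0) / v s) (Icc a x0) := by
      refine strictAntiOn_of_deriv_neg (convex_Icc a x0) (hgc 0 a x0 le_rfl hxb) ?_
      intro r hr
      rw [interior_Icc] at hr
      have hr' : r ∈ Ioo a b := ⟨hr.1, hr.2.trans hxb⟩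
      rw [(hgd 0 r hr').deriv]
      have h1 : W r < 0 := (hWmono hr' ⟨hax, hxb⟩ hr.2).trans_le hneg
      have h2 := hvp r ⟨hr'.1.le, hr'.2⟩
      have h3 := (hsub r hr').1
      refine div_neg_of_neg_of_pos ?_ (by positivity)
      have := div_neg_of_neg_of_pos h1 h3
      linarith
    have h := this (left_mem_Icc.2 hax.le) (right_mem_Icc.2 hax.le) hax
    simp only [hua, sub_zero, zero_div] at h
    have : 0 < u x0 / v x0 := div_pos hpos (hvp x0 ⟨hax.le, hxb⟩)
    linarith
  obtain ⟨M, hM⟩ := (isCompact_Icc (a := (0:ℝ)) (b := R)).exists_bound_of_continuousOn hdv.continuousOn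
  have hRpos : 0 < R := hx0a.trans hx0b
  have hM0 : 0 ≤ M := (norm_nonneg _).trans (hM 0 ⟨le_rfl, hRpos.le⟩)
  set e : ℝ := min (u x0) (W x0 / (R * (M + 1))) with he
  have hepos : 0 < e := lt_min hpos (by positivity)
  have he1 : e ≤ u x0 := min_le_left _ _
  have he2 : e * (R * (M + 1)) ≤ W x0 := by
    rw [← le_div_iff₀ (by positivity)]; exact min_le_right _ _
  have hge : ∀ t ∈ Ioo x0 b, e ≤ u t := by
    intro t ht
    have hmono : MonotoneOn (fun s => (u s - e) / v s) (Icc x0 t) := by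
      refine monotoneOn_of_deriv_nonneg (convex_Icc x0 t) (hgc e x0 t hax.le ht.2) ?_ ?_
      · intro r hr
        rw [interior_Icc] at hr
        exact (hgd e r ⟨hax.trans hr.1, hr.2.trans ht.2⟩).differentiableAt.differentiableWithinAt
      · intro r hr
        rw [interior_Icc] at hr
        have hr' : r ∈ Ioo a b := ⟨hax.trans hr.1, hr.2.trans ht.2⟩
        rw [(hgd e r hr').deriv]
        have h1 : W x0 < W r := hWmono ⟨hax, hxb⟩ hr' hr.1
        have h3 := hsub r hr'
        refine div_nonneg ?_ (sq_nonneg _)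
        have h4 := hM r ⟨h3.1.le, h3.2.le⟩
        rw [Real.norm_eq_abs, abs_le] at h4
        have h5 : e * (M + 1) ≤ W r / r := by
          rw [le_div_iff₀ h3.1]
          have : e * (M + 1) * r ≤ e * (M + 1) * R := by
            have := h3.2.le
            gcongr
          nlinarith
        nlinarith [h4.1]
    have h := hmono (left_mem_Icc.2 ht.1.le) (right_mem_Icc.2 ht.1.le) ht.1.le
    have h6 : 0 ≤ (u x0 - e) / v x0 := div_nonneg (by linarith) (hvp x0 ⟨hax.le, hxb⟩).le
    have h7 : 0 ≤ (u t - e) / v t := h6.trans h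
    have h8 := hvp t ⟨hax.le.trans ht.1.le, ht.2⟩
    have h9 := mul_nonneg h7 h8.le
    rw [div_mul_cancel₀ _ h8.ne'] at h9
    linarith
  have hcb : ContinuousWithinAt u (Ioo x0 b) b :=
    (hu b ⟨(hx0a.trans hxb).le, hbR⟩).mono
      (fun t ht => ⟨(hx0a.trans ht.1).le, (ht.2.le.trans hbR)⟩)
  have : (nhdsWithin b (Ioo x0 b)).NeBot := right_nhdsWithin_Ioo_neBot hxb
  have hfin : e ≤ u b := ge_of_tendsto hcb (eventually_mem_nhdsWithin.mono hge)
  linarith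

/-- necessary condition on the propagation constant. -/
theorem stmt0 (α : ℝ) (hα : 0 < α) (n : ℤ) (hn : 1 ≤ |n|) (κ R : ℝ) (hR : 0 < R)
    (u : ℝ → ℝ) (hu : IsVortexSol α n κ R u) (hE : FiniteEnergy α R u)
    (hnt : ∃ r ∈ Icc (0 : ℝ) R, u r ≠ 0) :
    κ < α⁻¹ - (besselR0 ^ 2 + (n : ℝ) ^ 2) / (2 * R ^ 2) := by
  by_contra hκ
  push Not at hκ
  obtain ⟨hc, hd, hu0, huR, hode⟩ := hu
  obtain ⟨x0, ⟨hx00, hx0R⟩, hne⟩ := hnt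
  have hx0 : x0 ∈ Ioo 0 R :=
    ⟨lt_of_le_of_ne hx00 (by rintro rfl; exact hne hu0),
      lt_of_le_of_ne hx0R (by rintro rfl; exact hne huR)⟩
  set k : ℝ := besselR0 / R with hk
  have hk0 : 0 ≤ k := div_nonneg besselR0_nonneg hR.le
  set q : ℝ → ℝ := fun r => (n : ℝ) ^ 2 / r ^ 2 + 2 * κ - 2 * (u r ^ 2 / (1 + α * u r ^ 2)) with hqdef
  have hq : ∀ r ∈ Ioo 0 R, -(k ^ 2) < q r := by
    intro r hr
    have h1 : u r ^ 2 / (1 + α * u r ^ 2) < α⁻¹ := by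
      rw [div_lt_iff₀ (by positivity)]
      have : α⁻¹ * (1 + α * u r ^ 2) = α⁻¹ + u r ^ 2 := by field_simp
      rw [this]
      have := inv_pos.2 hα
      linarith
    have h2 : (n : ℝ) ^ 2 / R ^ 2 ≤ (n : ℝ) ^ 2 / r ^ 2 := by
      have h3 := hr.1
      have h4 := hr.2.le
      gcongr
    have h5 : 2 * ((besselR0 ^ 2 + (n : ℝ) ^ 2) / (2 * R ^ 2)) = k ^ 2 + (n : ℝ) ^ 2 / R ^ 2 := by
      rw [hk]; field_simp
    simp only [hqdef]
    linarith
  have hdd : ∀ r ∈ Ioo 0 R, HasDerivAt (fun s => s * deriv u s) (r * q r * u r) r := by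
    intro r hr
    have h1 : DifferentiableAt ℝ (fun s => s * deriv u s) r :=
      differentiableAt_id.mul (hd r hr).2
    have h2 := hode r hr
    have h3 : deriv (fun s => s * deriv u s) r = r * q r * u r := by
      have hr0 := hr.1.ne'
      have hden : 1 + α * u r ^ 2 ≠ 0 := by positivity
      have : r * q r * u r = ((n : ℝ) ^ 2 / r) * u r
        - 2 * r * (u r) ^ 3 / (1 + α * (u r) ^ 2) + 2 * κ * r * u r := by
        simp only [hqdef]; field_simp; ring
      rw [this]; linarith
    rw [← h3]; exact h1.hasDerivAt
  set v : ℝ → ℝ := fun r => auxF ((k * r) ^ 2 / 4) with hvdef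
  set dv : ℝ → ℝ := fun r => auxF' ((k * r) ^ 2 / 4) * (k ^ 2 * r / 2) with hdvdef
  have hin : ∀ r : ℝ, HasDerivAt (fun r : ℝ => (k * r) ^ 2 / 4) (k ^ 2 * r / 2) r := by
    intro r
    have := ((((hasDerivAt_id r).const_mul k).pow 2).div_const 4)
    refine aux_congr this (fun s => by simp) ?_
    simp; ring
  have hv : ∀ r, HasDerivAt v (dv r) r := fun r => (auxF_deriv _).comp r (hin r)
  have hdv : Continuous dv := by
    refine (auxF'_cont.comp (by fun_prop)).mul (by fun_prop)
  have hvv : ∀ r, HasDerivAt (fun s => s * dv s) (-(k ^ 2 * r * v r)) r := by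
    intro r
    have h := ((aux_yF'_deriv ((k * r) ^ 2 / 4)).comp r (hin r)).const_mul 2
    refine aux_congr h (fun s => ?_) ?_
    · simp only [hdvdef, Function.comp]; ring
    · simp only [hvdef]; ring
  have hvpos : ∀ r ∈ Ico 0 R, 0 < v r := by
    intro r hr
    have : v r = besselJ0 (k * r) := by rw [besselJ0_eq]
    rw [this]
    apply besselJ0_pos (mul_nonneg hk0 hr.1)
    rcases besselR0_nonneg.eq_or_lt with h | h
    · right; rw [hk, ← h]; simp
    · left
      rw [hk, div_mul_eq_mul_div, div_lt_iff₀ hR]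
      exact mul_lt_mul_of_pos_left hr.2 h
  rcases lt_or_gt_of_ne hne with h | h
  · refine aux_core R (k ^ 2) (fun r => - u r) (fun r => - deriv u r) v dv q x0 hx0 hc.neg
      (by simp [hu0]) (by simp [huR]) (fun r hr => (hd r hr).1.hasDerivAt.neg) ?_ hq hv hdv hvv hvpos
      (by linarith)
    intro r hr
    refine aux_congr (hdd r hr).neg (fun s => ?_) ?_
    · simp
    · ring
  · exact aux_core R (k ^ 2) u (deriv u) v dv q x0 hx0 hc hu0 huR
      (fun r hr => (hd r hr).1.hasDerivAt) hdd hq hv hdv hvv hvpos h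
end

section
/- For every α > 0, every integer n with |n| ≥ 1, every R > 0 and every prescribed energy flux Q₀ > 0, there exist κ ∈ ℝ and a classical solution u of the n-vortex equation with parameters (α, n, κ, R) such that u has finite energy, u(r) > 0 for all r ∈ (0,R), and Q(u) = Q₀. -/
open MeasureTheory Set Filter

namespace Vtx
open scoped Topology InnerProductSpace

lemma weak_seq {H : Type*} [NormedAddCommGroup H] [InnerProductSpace ℝ H] [CompleteSpace H]
    [TopologicalSpace.SeparableSpace H] (x : ℕ → H) (M : ℝ) (hM : ∀ k, ‖x k‖ ≤ M) :
    ∃ (a : H) (φ : ℕ → ℕ), StrictMono φ ∧ ∀ y, Tendsto (fun k => ⟪x (φ k), y⟫_ℝ) atTop (𝓝 ⟪a, y⟫_ℝ) := by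
  have h := WeakDual.isSeqCompact_closedBall ℝ H 0 M
  obtain ⟨b, hb, φ, hφ, hlim⟩ := @h (fun k => StrongDual.toWeakDual (InnerProductSpace.toDual ℝ H (x k))) (by
    intro k
    simp only [mem_preimage, Metric.mem_closedBall, dist_zero_right]
    have : ‖InnerProductSpace.toDual ℝ H (x k)‖ ≤ M := by simpa using hM k
    exact this)
  refine ⟨(InnerProductSpace.toDual ℝ H).symm (WeakDual.toStrongDual b), φ, hφ, fun y => ?_⟩
  rw [InnerProductSpace.toDual_symm_apply]
  have := (tendsto_iff_forall_eval_tendsto_topDualPairing).1 hlim y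
  exact this

noncomputable abbrev mu (R : ℝ) : Measure ℝ := volume.restrict (Ioo 0 R)
abbrev HH (R : ℝ) : Type := Lp ℝ 2 (mu R)

instance HH_sep (R : ℝ) : TopologicalSpace.SeparableSpace (HH R) := by
  haveI : Fact ((2 : ENNReal) ≠ ⊤) := ⟨by simp⟩
  infer_instance

noncomputable def ee (m : ℕ) (s : ℝ) : ℝ := s ^ m * √s

lemma ee_cont (m : ℕ) : Continuous (ee m) := by unfold ee; fun_prop
lemma ee_nonneg (m : ℕ) {s : ℝ} (hs : 0 ≤ s) : 0 ≤ ee m s := by unfold ee; positivity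
lemma ee_pos (m : ℕ) {s : ℝ} (hs : 0 < s) : 0 < ee m s := by unfold ee; positivity
lemma ee_sq (m : ℕ) {s : ℝ} (hs : 0 ≤ s) : ee m s * ee m s = s ^ (2 * m + 1) := by
  unfold ee
  have := Real.mul_self_sqrt hs
  calc _ = (s ^ m) ^ 2 * (√s * √s) := by ring
    _ = _ := by rw [this]; ring
lemma ee_mono (m : ℕ) {s t : ℝ} (hs : 0 ≤ s) (h : s ≤ t) : ee m s ≤ ee m t := by
  have ht : 0 ≤ t := hs.trans h
  unfold ee
  gcongr

noncomputable def ker (m : ℕ) (r : ℝ) : ℝ → ℝ := (Ioc 0 r).indicator (ee m)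

lemma ker_meas (m : ℕ) (r : ℝ) : Measurable (ker m r) :=
  (ee_cont m).measurable.indicator measurableSet_Ioc

lemma ker_bound (m : ℕ) {r : ℝ} (hr : 0 ≤ r) (s : ℝ) : ‖ker m r s‖ ≤ ee m r := by
  unfold ker
  by_cases h : s ∈ Ioc 0 r
  · rw [indicator_of_mem h, Real.norm_of_nonneg (ee_nonneg m h.1.le)]
    exact ee_mono m h.1.le h.2
  · rw [indicator_of_notMem h, norm_zero]
    exact ee_nonneg m hr

lemma ker_bound' (m : ℕ) (r : ℝ) (s : ℝ) : ‖ker m r s‖ ≤ ee m |r| := by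
  by_cases hr : 0 ≤ r
  · rw [abs_of_nonneg hr]; exact ker_bound m hr s
  · unfold ker
    rw [Ioc_eq_empty (by push Not at hr ⊢; exact hr.le), indicator_empty]
    simp [ee_nonneg]

lemma ker_memLp (m : ℕ) (R r : ℝ) : MemLp (ker m r) 2 (mu R) :=
  MemLp.of_bound (ker_meas m r).aestronglyMeasurable (ee m |r|)
    (Eventually.of_forall (ker_bound' m r))

noncomputable def kk (m : ℕ) (R r : ℝ) : HH R := (ker_memLp m R r).toLp _

lemma inner_eq {R : ℝ} (f g : HH R) : ⟪f, g⟫_ℝ = ∫ s in Ioo 0 R, f s * g s := by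
  rw [L2.inner_def]
  congr 1; ext s; simp [mul_comm]

lemma normsq_eq {R : ℝ} (f : HH R) : ‖f‖ ^ 2 = ∫ s in Ioo 0 R, f s ^ 2 := by
  rw [← real_inner_self_eq_norm_sq, inner_eq]
  congr 1; ext s; ring

lemma inner_toLp {R : ℝ} {k : ℝ → ℝ} (hk : MemLp k 2 (mu R)) (g : HH R) :
    ⟪hk.toLp k, g⟫_ℝ = ∫ s in Ioo 0 R, k s * g s := by
  rw [inner_eq]
  apply integral_congr_ae
  filter_upwards [hk.coeFn_toLp] with s hs
  rw [hs]

lemma kk_norm (m : ℕ) (R : ℝ) {r : ℝ} (hr : 0 ≤ r) : ‖kk m R r‖ ≤ r ^ (m + 1) := by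
  have h1 : ‖kk m R r‖ ^ 2 ≤ (r ^ (m + 1)) ^ 2 := by
    rw [normsq_eq]
    have : ∫ s in Ioo 0 R, (kk m R r) s ^ 2 = ∫ s in Ioo 0 R, (Ioc 0 r).indicator (fun s => ee m s ^ 2) s := by
      apply integral_congr_ae
      filter_upwards [(ker_memLp m R r).coeFn_toLp] with s hs
      unfold kk
      rw [hs]
      unfold ker
      by_cases h : s ∈ Ioc 0 r
      · rw [indicator_of_mem h, indicator_of_mem h]
      · rw [indicator_of_notMem h, indicator_of_notMem h]; simp
    rw [this]
    calc _ ≤ ∫ s in Ioo 0 R, (Ioc 0 r).indicator (fun s => ee m r ^ 2) s := by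
            apply integral_mono_of_nonneg
            · refine Eventually.of_forall fun s => indicator_nonneg (fun x hx => ?_) s
              positivity
            · refine (integrable_const _).indicator measurableSet_Ioc
            · refine Eventually.of_forall fun s => ?_
              apply indicator_le_indicator'
              intro h
              have := ee_mono m h.1.le h.2
              have := ee_nonneg m h.1.le
              gcongr
      _ ≤ ∫ s : ℝ, (Ioc 0 r).indicator (fun s => ee m r ^ 2) s := by
            apply setIntegral_le_integral
            · rw [integrable_indicator_iff measurableSet_Ioc]
              exact integrableOn_const (by simp)
            · refine Eventually.of_forall fun s => indicator_nonneg (fun x hx => ?_) s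
              positivity
      _ = (r ^ (m + 1)) ^ 2 := by
            rw [integral_indicator measurableSet_Ioc, setIntegral_const]
            simp only [measureReal_def, Real.volume_Ioc, sub_zero, ENNReal.toReal_ofReal hr, smul_eq_mul]
            rw [sq (ee m r), ee_sq m hr]; ring
  exact le_of_sq_le_sq h1 (by positivity) 

lemma lp_mul_integrable {R : ℝ} {k : ℝ → ℝ} (hk : MemLp k 2 (mu R)) (g : HH R) :
    IntegrableOn (fun s => k s * g s) (Ioo 0 R) := by
  exact MemLp.integrable_mul hk (Lp.memLp g)

lemma ee_memLp (m : ℕ) (R : ℝ) : MemLp (ee m) 2 (mu R) := by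
  refine MemLp.of_bound (ee_cont m).aestronglyMeasurable (ee m |R|) ?_
  filter_upwards [ae_restrict_mem measurableSet_Ioo] with s hs
  rw [Real.norm_of_nonneg (ee_nonneg m hs.1.le)]
  exact ee_mono m hs.1.le (hs.2.le.trans (le_abs_self _))

/-- the integrand, extended by zero -/
noncomputable def GG (m : ℕ) (R : ℝ) (f : HH R) : ℝ → ℝ := (Ioo 0 R).indicator (fun s => ee m s * f s)

lemma GG_int (m : ℕ) (R : ℝ) (f : HH R) : Integrable (GG m R f) := by
  unfold GG
  rw [integrable_indicator_iff measurableSet_Ioo]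
  exact lp_mul_integrable (ee_memLp m R) f

noncomputable def YY (m : ℕ) (R : ℝ) (f : HH R) (r : ℝ) : ℝ := ∫ s in (0:ℝ)..r, GG m R f s

lemma YY_cont (m : ℕ) (R : ℝ) (f : HH R) : Continuous (YY m R f) :=
  intervalIntegral.continuous_primitive (fun _ _ => (GG_int m R f).intervalIntegrable) 0

lemma YY_eq (m : ℕ) (R : ℝ) (f : HH R) {r : ℝ} (hr : 0 ≤ r) : YY m R f r = ⟪kk m R r, f⟫_ℝ := by
  unfold kk YY GG
  rw [inner_toLp, intervalIntegral.integral_of_le hr, ← integral_indicator measurableSet_Ioc,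
    ← integral_indicator measurableSet_Ioo]
  congr 1; ext s
  unfold ker
  by_cases h : s ∈ Ioc 0 r <;> by_cases h' : s ∈ Ioo 0 R <;> simp [h, h']

lemma YY_zero (m : ℕ) (R : ℝ) (f : HH R) : YY m R f 0 = 0 := by simp [YY]

noncomputable def UU (m : ℕ) (R : ℝ) (f : HH R) (r : ℝ) : ℝ := YY m R f r / r ^ (m + 1)

lemma UU_contOn (m : ℕ) (R : ℝ) (f : HH R) : ContinuousOn (UU m R f) (Ioi 0) := by
  apply ContinuousOn.div (YY_cont m R f).continuousOn (by fun_prop)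
  intro x hx
  have : 0 < x := hx
  positivity

lemma UU_add (m : ℕ) (R : ℝ) (f g : HH R) {r : ℝ} (hr : 0 ≤ r) :
    UU m R (f + g) r = UU m R f r + UU m R g r := by
  unfold UU
  rw [YY_eq _ _ _ hr, YY_eq _ _ _ hr, YY_eq _ _ _ hr, inner_add_right, add_div]

lemma UU_smul (m : ℕ) (R : ℝ) (c : ℝ) (f : HH R) {r : ℝ} (hr : 0 ≤ r) :
    UU m R (c • f) r = c * UU m R f r := by
  unfold UU
  rw [YY_eq _ _ _ hr, YY_eq _ _ _ hr, inner_smul_right, mul_div_assoc]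

lemma YY_bound (m : ℕ) (R : ℝ) (f : HH R) {r : ℝ} (hr : 0 ≤ r) :
    |YY m R f r| ≤ r ^ (m + 1) * ‖f‖ := by
  rw [YY_eq _ _ _ hr]
  exact (abs_real_inner_le_norm _ _).trans (by gcongr; exact kk_norm m R hr)

lemma UU_bound (m : ℕ) (R : ℝ) (f : HH R) {r : ℝ} (hr : 0 < r) : |UU m R f r| ≤ ‖f‖ := by
  unfold UU
  rw [abs_div, abs_of_pos (by positivity : 0 < r ^ (m + 1)), div_le_iff₀ (by positivity), mul_comm]
  exact YY_bound m R f hr.le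

lemma bdd_int {R : ℝ} {F : ℝ → ℝ} (hF : ContinuousOn F (Ioo 0 R)) (B : ℝ)
    (hB : ∀ r ∈ Ioo 0 R, |F r| ≤ B) : IntegrableOn F (Ioo 0 R) := by
  refine Integrable.of_bound ?_ B ?_
  · exact hF.aestronglyMeasurable measurableSet_Ioo
  · filter_upwards [ae_restrict_mem measurableSet_Ioo] with s hs using hB s hs

end Vtx

namespace Vtx
open scoped Topology InnerProductSpace

lemma UU_contOn' (m : ℕ) (R : ℝ) (f : HH R) : ContinuousOn (UU m R f) (Ioo 0 R) :=
  (UU_contOn m R f).mono Ioo_subset_Ioi_self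

noncomputable def KK (m : ℕ) (R : ℝ) (f : HH R) : ℝ := ∫ r in Ioo 0 R, r * (UU m R f r) ^ 2
noncomputable def LL (α : ℝ) (m : ℕ) (R : ℝ) (f : HH R) : ℝ :=
  ∫ r in Ioo 0 R, r * Real.log (1 + α * (UU m R f r) ^ 2)
noncomputable def JJ (α : ℝ) (m : ℕ) (R : ℝ) (f : HH R) : ℝ :=
  ‖f‖ ^ 2 / 2 + (α ^ 2)⁻¹ * LL α m R f

lemma log_bd {x : ℝ} (hx : 0 ≤ x) : |Real.log (1 + x)| ≤ x := by
  rw [abs_of_nonneg (Real.log_nonneg (by linarith))]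
  have := Real.log_le_sub_one_of_pos (by linarith : 0 < 1 + x)
  linarith

lemma UUsq_bound (m : ℕ) (R : ℝ) (f : HH R) {M : ℝ} (hM : ‖f‖ ≤ M) {r : ℝ} (hr : 0 < r) :
    UU m R f r ^ 2 ≤ M ^ 2 := by
  rw [← sq_abs]
  have := (UU_bound m R f hr).trans hM
  gcongr

lemma K_bd (m : ℕ) (R : ℝ) (f : HH R) {M : ℝ} (hM : ‖f‖ ≤ M) :
    ∀ r ∈ Ioo 0 R, |r * (UU m R f r) ^ 2| ≤ R * M ^ 2 := by
  intro r hr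
  have := UUsq_bound m R f hM hr.1
  have h1 := hr.1
  have h2 := hr.2
  have h0 : 0 ≤ R := (h1.trans h2).le
  rw [abs_mul, abs_of_pos h1, abs_of_nonneg (sq_nonneg _)]
  gcongr

lemma L_bd {α : ℝ} (hα : 0 < α) (m : ℕ) (R : ℝ) (f : HH R) {M : ℝ} (hM : ‖f‖ ≤ M) :
    ∀ r ∈ Ioo 0 R, |r * Real.log (1 + α * (UU m R f r) ^ 2)| ≤ R * (α * M ^ 2) := by
  intro r hr
  have := UUsq_bound m R f hM hr.1
  have h1 := hr.1
  have h2 := hr.2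
  have h0 : 0 ≤ R := (h1.trans h2).le
  rw [abs_mul, abs_of_pos h1]
  have h3 : |Real.log (1 + α * (UU m R f r) ^ 2)| ≤ α * (UU m R f r) ^ 2 := log_bd (by positivity)
  have h4 := h3.trans (mul_le_mul_of_nonneg_left this hα.le)
  gcongr

lemma K_cont (m : ℕ) (R : ℝ) (f : HH R) : ContinuousOn (fun r => r * (UU m R f r) ^ 2) (Ioo 0 R) := by
  have := UU_contOn' m R f
  fun_prop

lemma L_cont {α : ℝ} (hα : 0 < α) (m : ℕ) (R : ℝ) (f : HH R) :
    ContinuousOn (fun r => r * Real.log (1 + α * (UU m R f r) ^ 2)) (Ioo 0 R) := by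
  have := UU_contOn' m R f
  apply continuousOn_id.mul
  apply ContinuousOn.log (by fun_prop)
  intro x _
  positivity

lemma K_int (m : ℕ) (R : ℝ) (f : HH R) : IntegrableOn (fun r => r * (UU m R f r) ^ 2) (Ioo 0 R) :=
  bdd_int (K_cont m R f) _ (K_bd m R f le_rfl)

lemma L_int {α : ℝ} (hα : 0 < α) (m : ℕ) (R : ℝ) (f : HH R) :
    IntegrableOn (fun r => r * Real.log (1 + α * (UU m R f r) ^ 2)) (Ioo 0 R) :=
  bdd_int (L_cont hα m R f) _ (L_bd hα m R f le_rfl)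

lemma LL_nonneg {α : ℝ} (hα : 0 < α) (m : ℕ) (R : ℝ) (f : HH R) : 0 ≤ LL α m R f := by
  apply setIntegral_nonneg measurableSet_Ioo
  intro r hr
  have := hr.1
  have h : 0 ≤ Real.log (1 + α * (UU m R f r) ^ 2) :=
    Real.log_nonneg (by have : 0 ≤ α * (UU m R f r) ^ 2 := by positivity
                        linarith)
  positivity

lemma KK_smul (m : ℕ) (R c : ℝ) (f : HH R) : KK m R (c • f) = c ^ 2 * KK m R f := by
  unfold KK
  rw [← integral_const_mul]
  apply setIntegral_congr_fun measurableSet_Ioo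
  intro r hr
  simp only
  rw [UU_smul m R c f hr.1.le]; ring

lemma YY_smul (m : ℕ) (R c : ℝ) (f : HH R) {r : ℝ} (hr : 0 ≤ r) :
    YY m R (c • f) r = c * YY m R f r := by
  rw [YY_eq _ _ _ hr, YY_eq _ _ _ hr, inner_smul_right]

lemma YY_add (m : ℕ) (R : ℝ) (f g : HH R) {r : ℝ} (hr : 0 ≤ r) :
    YY m R (f + g) r = YY m R f r + YY m R g r := by
  rw [YY_eq _ _ _ hr, YY_eq _ _ _ hr, YY_eq _ _ _ hr, inner_add_right]

lemma KK_pos (m : ℕ) {R : ℝ} (f : HH R) {r : ℝ} (hr : r ∈ Ioo 0 R) (h : UU m R f r ≠ 0) :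
    0 < KK m R f := by
  unfold KK
  rw [setIntegral_pos_iff_support_of_nonneg_ae]
  · have hc := K_cont m R f
    have ho : IsOpen (Ioo 0 R ∩ (fun r => r * (UU m R f r) ^ 2) ⁻¹' {0}ᶜ) :=
      hc.isOpen_inter_preimage isOpen_Ioo isOpen_compl_singleton
    have := ho.measure_pos volume ⟨r, hr, by have := hr.1.ne'; simp [this, h]⟩
    rw [inter_comm] at this
    exact this
  · filter_upwards [ae_restrict_mem measurableSet_Ioo] with s hs
    have := hs.1
    simp only [Pi.zero_apply]
    positivity
  · exact K_int m R f

/-- an explicit element of the constraint set -/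
lemma exists_test (m : ℕ) {R : ℝ} (hR : 0 < R) : ∃ f : HH R, YY m R f R = 0 ∧ 0 < KK m R f := by
  let p : ℝ → ℝ := fun s => ee m s * ((2 * m + 2) * R - (2 * m + 3) * s)
  have hpc : Continuous p := by have := ee_cont m; fun_prop
  have hp : MemLp p 2 (mu R) := by
    obtain ⟨B, hB⟩ := (isCompact_Icc (a := (0:ℝ)) (b := R)).exists_bound_of_continuousOn hpc.continuousOn
    refine MemLp.of_bound hpc.aestronglyMeasurable B ?_
    filter_upwards [ae_restrict_mem measurableSet_Ioo] with s hs using hB s (Ioo_subset_Icc_self hs)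
  have hY : ∀ r ∈ Icc 0 R, YY m R (hp.toLp p) r = r ^ (2 * m + 2) * (R - r) := by
    intro r hr
    have h1 : YY m R (hp.toLp p) r = ∫ s in (0:ℝ)..r, ((2 * m + 2) * R * s ^ (2 * m + 1) - (2 * m + 3) * s ^ (2 * m + 2)) := by
      unfold YY GG
      apply intervalIntegral.integral_congr_ae
      have := hp.coeFn_toLp
      rw [Filter.EventuallyEq, ae_restrict_iff' measurableSet_Ioo] at this
      have hne : ∀ᵐ s : ℝ, s ≠ R := by simp [ae_iff]
      filter_upwards [this, hne] with s hs hsR hs2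
      rw [uIoc_of_le hr.1] at hs2
      have hmem : s ∈ Ioo 0 R := ⟨hs2.1, lt_of_le_of_ne (hs2.2.trans hr.2) hsR⟩
      rw [indicator_of_mem hmem, hs hmem]
      simp only [p]
      rw [← mul_assoc, ee_sq m hmem.1.le]; ring
    rw [h1]
    have : ∀ s ∈ uIcc 0 r, HasDerivAt (fun s : ℝ => s ^ (2 * m + 2) * (R - s))
        ((2 * m + 2) * R * s ^ (2 * m + 1) - (2 * m + 3) * s ^ (2 * m + 2)) s := by
      intro s _
      have h := (hasDerivAt_pow (2 * m + 2) s).mul ((hasDerivAt_id s).const_sub R)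
      convert! h using 1
      push_cast
      simp only [id]
      ring
    rw [intervalIntegral.integral_eq_sub_of_hasDerivAt this]
    · simp
    · apply Continuous.intervalIntegrable; fun_prop
  refine ⟨hp.toLp p, ?_, ?_⟩
  · rw [hY R ⟨hR.le, le_rfl⟩]; simp
  · have hr : R / 2 ∈ Ioo 0 R := ⟨by linarith, by linarith⟩
    apply KK_pos m _ hr
    unfold UU
    rw [hY _ (Ioo_subset_Icc_self hr)]
    have : 0 < R - R / 2 := by linarith
    positivity

lemma exists_min {α : ℝ} (hα : 0 < α) (m : ℕ) {R : ℝ} (hR : 0 < R) {c : ℝ} (hc : 0 < c) :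
    ∃ v : HH R, YY m R v R = 0 ∧ KK m R v = c ∧
      ∀ w : HH R, YY m R w R = 0 → KK m R w = c → JJ α m R v ≤ JJ α m R w := by
  let S : Set ℝ := JJ α m R '' {w | YY m R w R = 0 ∧ KK m R w = c}
  have hne : S.Nonempty := by
    obtain ⟨f, hf1, hf2⟩ := exists_test m hR
    refine ⟨_, √(c / KK m R f) • f, ⟨?_, ?_⟩, rfl⟩
    · rw [YY_smul _ _ _ _ hR.le, hf1, mul_zero]
    · rw [KK_smul, Real.sq_sqrt (by positivity)]; field_simp
  have hnn : ∀ f, 0 ≤ JJ α m R f := fun f => by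
    have := LL_nonneg hα m R f
    unfold JJ; positivity
  have hbdd : BddBelow S := ⟨0, by rintro _ ⟨f, _, rfl⟩; exact hnn f⟩
  obtain ⟨a, ha_anti, ha_lim, ha_mem⟩ := exists_seq_tendsto_sInf hne hbdd
  choose x hx hxa using ha_mem
  have hbound : ∀ k, ‖x k‖ ≤ √(2 * a 0) := by
    intro k
    apply Real.le_sqrt_of_sq_le
    have h1 : a k ≤ a 0 := ha_anti (Nat.zero_le k)
    have h2 := hxa k
    have h3 := LL_nonneg hα m R (x k)
    have h4 : 0 ≤ (α ^ 2)⁻¹ * LL α m R (x k) := by positivity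
    unfold JJ at h2
    linarith
  obtain ⟨v, φ, hφ, hw⟩ := weak_seq x _ hbound
  set M := √(2 * a 0)
  have hYlim : ∀ r, 0 ≤ r → Tendsto (fun k => YY m R (x (φ k)) r) atTop (𝓝 (YY m R v r)) := by
    intro r hr
    simp_rw [YY_eq _ _ _ hr, real_inner_comm]
    simpa only [real_inner_comm] using hw (kk m R r)
  have hUlim : ∀ r ∈ Ioo 0 R, Tendsto (fun k => UU m R (x (φ k)) r) atTop (𝓝 (UU m R v r)) := by
    intro r hr
    exact (hYlim r hr.1.le).div_const _
  have hK : Tendsto (fun k => KK m R (x (φ k))) atTop (𝓝 (KK m R v)) := by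
    apply tendsto_integral_of_dominated_convergence (fun _ => R * M ^ 2)
    · intro k; exact (K_int m R _).aestronglyMeasurable
    · exact integrable_const _
    · intro k
      filter_upwards [ae_restrict_mem measurableSet_Ioo] with s hs using K_bd m R _ (hbound _) s hs
    · filter_upwards [ae_restrict_mem measurableSet_Ioo] with s hs
      exact ((hUlim s hs).pow 2).const_mul s
  have hL : Tendsto (fun k => LL α m R (x (φ k))) atTop (𝓝 (LL α m R v)) := by
    apply tendsto_integral_of_dominated_convergence (fun _ => R * (α * M ^ 2))
    · intro k; exact (L_int hα m R _).aestronglyMeasurable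
    · exact integrable_const _
    · intro k
      filter_upwards [ae_restrict_mem measurableSet_Ioo] with s hs using L_bd hα m R _ (hbound _) s hs
    · filter_upwards [ae_restrict_mem measurableSet_Ioo] with s hs
      apply Tendsto.const_mul
      apply Tendsto.log
      · exact (((hUlim s hs).pow 2).const_mul α).const_add 1
      · positivity
  have hYR : YY m R v R = 0 := by
    refine tendsto_nhds_unique (hYlim R hR.le) ?_
    simp_rw [(hx _).1]; exact tendsto_const_nhds
  have hKv : KK m R v = c := by
    refine tendsto_nhds_unique hK ?_
    simp_rw [(hx _).2]; exact tendsto_const_nhds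
  refine ⟨v, hYR, hKv, fun w hw1 hw2 => ?_⟩
  have hle : JJ α m R v ≤ sInf S := by
    have h1 : Tendsto (fun k => ⟪x (φ k), v⟫_ℝ - ‖v‖ ^ 2 / 2 + (α ^ 2)⁻¹ * LL α m R (x (φ k))) atTop
        (𝓝 (⟪v, v⟫_ℝ - ‖v‖ ^ 2 / 2 + (α ^ 2)⁻¹ * LL α m R v)) :=
      ((hw v).sub_const _).add (hL.const_mul _)
    have h2 : ⟪v, v⟫_ℝ - ‖v‖ ^ 2 / 2 + (α ^ 2)⁻¹ * LL α m R v = JJ α m R v := by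
      rw [real_inner_self_eq_norm_sq]; unfold JJ; ring
    rw [h2] at h1
    refine le_of_tendsto_of_tendsto' h1 (ha_lim.comp hφ.tendsto_atTop) fun k => ?_
    simp only [Function.comp]
    rw [← hxa]
    unfold JJ
    have := norm_sub_sq_real (x (φ k)) v
    have := sq_nonneg ‖x (φ k) - v‖
    linarith
  exact hle.trans (csInf_le hbdd ⟨w, ⟨hw1, hw2⟩, rfl⟩)

end Vtx

namespace Vtx
open scoped Topology InnerProductSpace

noncomputable def BB (m : ℕ) (R : ℝ) (g : ℝ → ℝ) (f w : HH R) : ℝ :=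
  ∫ r in Ioo 0 R, r * g r * UU m R f r * UU m R w r

lemma B_int (m : ℕ) {R : ℝ} {g : ℝ → ℝ} (hgc : ContinuousOn g (Ioo 0 R)) {G : ℝ}
    (hgb : ∀ r ∈ Ioo 0 R, |g r| ≤ G) (f w : HH R) :
    IntegrableOn (fun r => r * g r * UU m R f r * UU m R w r) (Ioo 0 R) := by
  refine bdd_int ?_ (R * G * ‖f‖ * ‖w‖) ?_
  · have := UU_contOn' m R f
    have := UU_contOn' m R w
    fun_prop
  · intro r hr
    have h1 := hr.1
    have h2 := hr.2
    have h0 : 0 ≤ R := (h1.trans h2).le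
    have h3 := UU_bound m R f h1
    have h4 := UU_bound m R w h1
    have h5 := hgb r hr
    have h6 : 0 ≤ G := (abs_nonneg _).trans h5
    rw [abs_mul, abs_mul, abs_mul, abs_of_pos h1]
    gcongr

lemma BB_smul_self (m : ℕ) (R : ℝ) (g : ℝ → ℝ) (c : ℝ) (f : HH R) :
    BB m R g (c • f) (c • f) = c ^ 2 * BB m R g f f := by
  unfold BB
  rw [← integral_const_mul]
  apply setIntegral_congr_fun measurableSet_Ioo
  intro r hr
  simp only
  rw [UU_smul m R c f hr.1.le]; ring

lemma BB_expand (m : ℕ) {R : ℝ} {g : ℝ → ℝ} (hgc : ContinuousOn g (Ioo 0 R)) {G : ℝ}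
    (hgb : ∀ r ∈ Ioo 0 R, |g r| ≤ G) (f w : HH R) (t : ℝ) :
    BB m R g (f + t • w) (f + t • w) = BB m R g f f + 2 * t * BB m R g f w + t ^ 2 * BB m R g w w := by
  unfold BB
  rw [← integral_const_mul, ← integral_const_mul, ← integral_add, ← integral_add]
  · apply setIntegral_congr_fun measurableSet_Ioo
    intro r hr
    simp only
    rw [UU_add m R _ _ hr.1.le, UU_smul m R _ _ hr.1.le]; ring
  · exact (B_int m hgc hgb f f).add ((B_int m hgc hgb f w).const_mul _)
  · exact (B_int m hgc hgb w w).const_mul _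
  · exact B_int m hgc hgb f f
  · exact (B_int m hgc hgb f w).const_mul _

lemma EL (m : ℕ) {R : ℝ} (hR : 0 < R) {g : ℝ → ℝ} (hgc : ContinuousOn g (Ioo 0 R)) {G : ℝ}
    (hgb : ∀ r ∈ Ioo 0 R, |g r| ≤ G)
    (hpos : ∀ w : HH R, YY m R w R = 0 → 0 ≤ ‖w‖ ^ 2 + BB m R g w w)
    (f : HH R) (hf : YY m R f R = 0) (hf0 : ‖f‖ ^ 2 + BB m R g f f = 0)
    (w : HH R) (hw : YY m R w R = 0) : ⟪f, w⟫_ℝ + BB m R g f w = 0 := by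
  set b := ⟪f, w⟫_ℝ + BB m R g f w with hb
  set e := ‖w‖ ^ 2 + BB m R g w w with he
  have he0 : 0 ≤ e := hpos w hw
  have key : ∀ t : ℝ, 0 ≤ 2 * t * b + t ^ 2 * e := by
    intro t
    have h1 := hpos (f + t • w) (by rw [YY_add _ _ _ _ hR.le, YY_smul _ _ _ _ hR.le, hf, hw]; ring)
    rw [BB_expand m hgc hgb, norm_add_sq_real, inner_smul_right, norm_smul, mul_pow, Real.norm_eq_abs, sq_abs] at h1
    have : 2 * t * b + t ^ 2 * e = 2 * t * ⟪f, w⟫_ℝ + 2 * t * BB m R g f w + t ^ 2 * ‖w‖ ^ 2 + t ^ 2 * BB m R g w w := by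
      rw [hb, he]; ring
    linarith
  have h := key (-b / (e + 1))
  have h2 : 2 * (-b / (e + 1)) * b + (-b / (e + 1)) ^ 2 * e = -(b ^ 2 * ((e + 2) / (e + 1) ^ 2)) := by
    field_simp; ring
  rw [h2] at h
  have h3 : 0 < (e + 2) / (e + 1) ^ 2 := by positivity
  have h4 : b ^ 2 ≤ 0 := by
    by_contra hcon
    push Not at hcon
    have := mul_pos hcon h3
    linarith
  exact pow_eq_zero_iff (two_ne_zero) |>.1 (le_antisymm h4 (sq_nonneg b))

lemma log_concave {α s t : ℝ} (hα : 0 < α) (hs : 0 ≤ s) (ht : 0 ≤ t) :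
    Real.log (1 + α * t) ≤ Real.log (1 + α * s) + α * (t - s) / (1 + α * s) := by
  have h1 : 0 < 1 + α * s := by positivity
  have h2 : 0 < 1 + α * t := by positivity
  have h3 := Real.log_le_sub_one_of_pos (div_pos h2 h1)
  rw [Real.log_div h2.ne' h1.ne'] at h3
  have : (1 + α * t) / (1 + α * s) - 1 = α * (t - s) / (1 + α * s) := by field_simp; ring
  linarith

noncomputable def PP (α : ℝ) (m : ℕ) (R : ℝ) (v : HH R) (r : ℝ) : ℝ :=
  2 / α / (1 + α * (UU m R v r) ^ 2)

lemma PP_cont {α : ℝ} (hα : 0 < α) (m : ℕ) (R : ℝ) (v : HH R) :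
    ContinuousOn (PP α m R v) (Ioo 0 R) := by
  have := UU_contOn' m R v
  apply ContinuousOn.div (by fun_prop) (by fun_prop)
  intro x _
  positivity

lemma PP_nonneg {α : ℝ} (hα : 0 < α) (m : ℕ) (R : ℝ) (v : HH R) (r : ℝ) : 0 ≤ PP α m R v r := by
  unfold PP; positivity

lemma PP_bd {α : ℝ} (hα : 0 < α) (m : ℕ) (R : ℝ) (v : HH R) (r : ℝ) : |PP α m R v r| ≤ 2 / α := by
  rw [abs_of_nonneg (PP_nonneg hα m R v r)]
  unfold PP
  apply div_le_self (by positivity)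
  have : 0 ≤ α * (UU m R v r) ^ 2 := by positivity
  linarith

lemma KK_nonneg (m : ℕ) (R : ℝ) (f : HH R) : 0 ≤ KK m R f := by
  apply setIntegral_nonneg measurableSet_Ioo
  intro r hr
  have := hr.1
  positivity

lemma quad {α : ℝ} (hα : 0 < α) (m : ℕ) {R : ℝ} (hR : 0 < R) {c : ℝ} (hc : 0 < c) (v : HH R)
    (hvK : KK m R v = c)
    (hmin : ∀ w : HH R, YY m R w R = 0 → KK m R w = c → JJ α m R v ≤ JJ α m R w) :
    ∃ μ : ℝ, (‖v‖ ^ 2 + BB m R (fun r => PP α m R v r - μ) v v = 0) ∧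
      ∀ w : HH R, YY m R w R = 0 → 0 ≤ ‖w‖ ^ 2 + BB m R (fun r => PP α m R v r - μ) w w := by
  set P := PP α m R v with hP
  have hPi : ∀ f w : HH R, IntegrableOn (fun r => r * P r * UU m R f r * UU m R w r) (Ioo 0 R) :=
    B_int m (PP_cont hα m R v) (fun r _ => PP_bd hα m R v r)
  have step : ∀ w : HH R, YY m R w R = 0 → KK m R w = c →
      ‖v‖ ^ 2 + BB m R P v v ≤ ‖w‖ ^ 2 + BB m R P w w := by
    intro w hw hwK
    have h1 := hmin w hw hwK
    have h2 : LL α m R w ≤ LL α m R v + α ^ 2 / 2 * (BB m R P w w - BB m R P v v) := by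
      unfold LL BB
      rw [← integral_sub (hPi w w) (hPi v v), ← integral_const_mul, ← integral_add]
      · apply setIntegral_mono_on (L_int hα m R w) _ measurableSet_Ioo
        · intro r hr
          have h := log_concave hα (sq_nonneg (UU m R v r)) (sq_nonneg (UU m R w r))
          have h' := mul_le_mul_of_nonneg_left h hr.1.le
          refine h'.trans (le_of_eq ?_)
          simp only [hP, PP]
          have : 0 < 1 + α * UU m R v r ^ 2 := by positivity
          field_simp
        · exact (L_int hα m R v).add (((hPi w w).sub (hPi v v)).const_mul _)
      · exact L_int hα m R v
      · exact ((hPi w w).sub (hPi v v)).const_mul _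
    unfold JJ at h1
    have h3 : (α ^ 2)⁻¹ * LL α m R w ≤ (α ^ 2)⁻¹ * LL α m R v + 1 / 2 * (BB m R P w w - BB m R P v v) := by
      have := mul_le_mul_of_nonneg_left h2 (by positivity : 0 ≤ (α ^ 2)⁻¹)
      refine this.trans (le_of_eq ?_)
      field_simp
    linarith
  have hsplit : ∀ (μ : ℝ) (w : HH R), BB m R (fun r => P r - μ) w w = BB m R P w w - μ * KK m R w := by
    intro μ w
    unfold BB KK
    rw [← integral_const_mul, ← integral_sub (hPi w w) ((K_int m R w).const_mul _)]
    congr 1; ext r; ring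
  refine ⟨(‖v‖ ^ 2 + BB m R P v v) / c, ?_, ?_⟩
  · rw [hsplit, hvK]; field_simp; ring
  · intro w hw
    rw [hsplit]
    rcases (KK_nonneg m R w).eq_or_lt with h0 | h0
    · rw [← h0]
      have : 0 ≤ BB m R P w w := by
        apply setIntegral_nonneg measurableSet_Ioo
        intro r hr
        have h1 := hr.1
        have h2 := PP_nonneg hα m R v r
        have h3 := mul_self_nonneg (UU m R w r)
        rw [mul_assoc]
        positivity
      have := sq_nonneg ‖w‖
      linarith
    · have h1 := step (√(c / KK m R w) • w) (by rw [YY_smul _ _ _ _ hR.le, hw, mul_zero])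
        (by rw [KK_smul, Real.sq_sqrt (by positivity)]; field_simp)
      rw [BB_smul_self, norm_smul, mul_pow, Real.norm_eq_abs, sq_abs, Real.sq_sqrt (by positivity)] at h1
      have h2 : c / KK m R w * ‖w‖ ^ 2 + c / KK m R w * BB m R P w w = c / KK m R w * (‖w‖ ^ 2 + BB m R P w w) := by ring
      rw [h2, div_mul_eq_mul_div, le_div_iff₀ h0] at h1
      have h3 : (‖v‖ ^ 2 + BB m R P v v) / c * KK m R w ≤ ‖w‖ ^ 2 + BB m R P w w := by
        rw [div_mul_eq_mul_div, div_le_iff₀ hc]; linarith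
      linarith

end Vtx

namespace Vtx
open scoped Topology InnerProductSpace

/-- the tail integral -/
noncomputable def Hh (m : ℕ) (R : ℝ) (h : ℝ → ℝ) (s : ℝ) : ℝ := ∫ t in s..R, h t / t ^ m

lemma h_int (m : ℕ) {R : ℝ} {h : ℝ → ℝ} (hc : ContinuousOn h (Ioo 0 R)) {B : ℝ}
    (hB : ∀ r ∈ Ioo 0 R, |h r| ≤ B) {s : ℝ} (hs : s ∈ Ioo 0 R) :
    IntervalIntegrable (fun t => h t / t ^ m) volume s R := by
  rw [intervalIntegrable_iff_integrableOn_Ioo_of_le hs.2.le]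
  refine Integrable.of_bound ?_ (B / s ^ m) ?_
  · apply ContinuousOn.aestronglyMeasurable _ measurableSet_Ioo
    apply ContinuousOn.div (hc.mono (Ioo_subset_Ioo_left hs.1.le)) (by fun_prop)
    intro x hx
    have : 0 < x := hs.1.trans hx.1
    positivity
  · filter_upwards [ae_restrict_mem measurableSet_Ioo] with t ht
    have h1 := hB t ⟨hs.1.trans ht.1, ht.2⟩
    have h0 : 0 ≤ B := (abs_nonneg _).trans h1
    have h2 := hs.1
    have h3 := ht.1
    have h4 := h2.trans h3
    rw [norm_div, Real.norm_eq_abs, norm_pow, Real.norm_of_nonneg h4.le]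
    gcongr

lemma Hh_deriv (m : ℕ) {R : ℝ} {h : ℝ → ℝ} (hc : ContinuousOn h (Ioo 0 R)) {B : ℝ}
    (hB : ∀ r ∈ Ioo 0 R, |h r| ≤ B) {s : ℝ} (hs : s ∈ Ioo 0 R) :
    HasDerivAt (Hh m R h) (-(h s / s ^ m)) s := by
  have hcc : ContinuousOn (fun t => h t / t ^ m) (Ioo 0 R) := by
    apply ContinuousOn.div hc (by fun_prop)
    intro x hx
    have : 0 < x := hx.1
    positivity
  refine intervalIntegral.integral_hasDerivAt_left (h_int m hc hB hs) ?_ ?_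
  · exact hcc.stronglyMeasurableAtFilter isOpen_Ioo s hs
  · exact hcc.continuousAt (isOpen_Ioo.mem_nhds hs)

lemma Hh_bd (m : ℕ) {R : ℝ} {h : ℝ → ℝ} {B : ℝ}
    (hB : ∀ r ∈ Ioo 0 R, |h r| ≤ B) {s : ℝ} (hs : s ∈ Ioo 0 R) :
    |s ^ m * Hh m R h s| ≤ B * R := by
  have h0 : 0 ≤ B := (abs_nonneg _).trans (hB s hs)
  have hs0 := hs.1
  have h1 : ‖∫ t in s..R, h t / t ^ m‖ ≤ (B / s ^ m) * |R - s| := by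
    apply intervalIntegral.norm_integral_le_of_norm_le_const_ae
    have hne : ∀ᵐ s : ℝ, s ≠ R := by simp [ae_iff]
    filter_upwards [hne] with t htR ht
    rw [uIoc_of_le hs.2.le] at ht
    have hm : t ∈ Ioo 0 R := ⟨hs0.trans ht.1, lt_of_le_of_ne ht.2 htR⟩
    have := hB t hm
    have h3 := ht.1
    rw [norm_div, Real.norm_eq_abs, norm_pow, Real.norm_of_nonneg hm.1.le]
    gcongr
  rw [abs_mul, abs_of_pos (by positivity : 0 < s ^ m)]
  unfold Hh
  rw [Real.norm_eq_abs] at h1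
  calc _ ≤ s ^ m * ((B / s ^ m) * |R - s|) := by gcongr
    _ = B * |R - s| := by field_simp
    _ ≤ B * R := by
      rw [abs_of_pos (by linarith [hs.2])]
      gcongr; linarith

lemma q_memLp (m : ℕ) {R : ℝ} {h : ℝ → ℝ} (hc : ContinuousOn h (Ioo 0 R)) {B : ℝ}
    (hB : ∀ r ∈ Ioo 0 R, |h r| ≤ B) : MemLp (fun s => ee m s * Hh m R h s) 2 (mu R) := by
  refine MemLp.of_bound ?_ (√R * (B * R)) ?_
  · apply ContinuousOn.aestronglyMeasurable _ measurableSet_Ioo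
    apply (ee_cont m).continuousOn.mul
    intro s hs
    exact (Hh_deriv m hc hB hs).continuousAt.continuousWithinAt
  · filter_upwards [ae_restrict_mem measurableSet_Ioo] with s hs
    have h1 := Hh_bd m hB hs
    have : ee m s * Hh m R h s = √s * (s ^ m * Hh m R h s) := by unfold ee; ring
    rw [this, Real.norm_eq_abs, abs_mul, abs_of_nonneg (Real.sqrt_nonneg s)]
    have := Real.sqrt_le_sqrt hs.2.le
    gcongr

lemma fubini (m : ℕ) {R : ℝ} {h : ℝ → ℝ} (hc : ContinuousOn h (Ioo 0 R)) {B : ℝ}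
    (hB : ∀ r ∈ Ioo 0 R, |h r| ≤ B) (w : HH R) :
    ∫ r in Ioo 0 R, r * h r * UU m R w r = ∫ s in Ioo 0 R, (ee m s * Hh m R h s) * w s := by
  let F : ℝ → ℝ → ℝ := fun r s => h r / r ^ m * ker m r s * w s
  have hF : Integrable (Function.uncurry F) ((mu R).prod (mu R)) := by
    have hdom : Integrable (fun z : ℝ × ℝ => B * √R * |w z.2|) ((mu R).prod (mu R)) := by
      have hw : Integrable (w : ℝ → ℝ) (mu R) := (Lp.memLp w).integrable (by norm_num)
      have := (hw.abs.const_mul (B * √R)).comp_snd (mu R)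
      exact this
    refine hdom.mono' ?_ ?_
    · apply AEStronglyMeasurable.mul
      · apply AEStronglyMeasurable.mul
        · have : AEStronglyMeasurable (fun r => h r / r ^ m) (mu R) := by
            apply ContinuousOn.aestronglyMeasurable _ measurableSet_Ioo
            apply ContinuousOn.div hc (by fun_prop)
            intro x hx
            have : 0 < x := hx.1
            positivity
          exact this.comp_fst
        · apply Measurable.aestronglyMeasurable
          have : (fun z : ℝ × ℝ => ker m z.1 z.2) =
              {z : ℝ × ℝ | 0 < z.2 ∧ z.2 ≤ z.1}.indicator (fun z => ee m z.2) := by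
            ext z
            unfold ker
            by_cases hz : 0 < z.2 ∧ z.2 ≤ z.1
            · rw [indicator_of_mem (show z.2 ∈ Ioc 0 z.1 from hz), indicator_of_mem (show z ∈ _ from hz)]
            · rw [indicator_of_notMem (show z.2 ∉ Ioc 0 z.1 from hz), indicator_of_notMem (show z ∉ _ from hz)]
          show Measurable (fun z : ℝ × ℝ => ker m z.1 z.2)
          rw [this]
          apply Measurable.indicator
          · exact ((ee_cont m).comp continuous_snd).measurable
          · exact (measurableSet_lt measurable_const measurable_snd).inter
              (measurableSet_le measurable_snd measurable_fst)
      · exact (Lp.aestronglyMeasurable w).comp_snd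
    · have h1 : ∀ᵐ z ∂((mu R).prod (mu R)), z.1 ∈ Ioo 0 R := by
        have : ∀ᵐ r ∂(mu R), r ∈ Ioo 0 R := ae_restrict_mem measurableSet_Ioo
        exact Measure.quasiMeasurePreserving_fst.ae this
      filter_upwards [h1] with z hz
      obtain ⟨r, s⟩ := z
      simp only [Function.uncurry, F] at hz ⊢
      have hb := hB r hz
      have h0 : 0 ≤ B := (abs_nonneg _).trans hb
      have hr := hz.1
      rw [norm_mul, norm_mul, norm_div, norm_pow, Real.norm_of_nonneg hr.le]
      have hk := ker_bound m hr.le s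
      have hsq := Real.sqrt_le_sqrt hz.2.le
      calc ‖h r‖ / r ^ m * ‖ker m r s‖ * ‖w s‖ ≤ B / r ^ m * ee m r * ‖w s‖ := by
            gcongr
            exact hb
        _ = B * √r * |w s| := by unfold ee; rw [Real.norm_eq_abs]; field_simp
        _ ≤ B * √R * |w s| := by gcongr
  have hswap := integral_integral_swap hF
  have hL : ∫ r in Ioo 0 R, r * h r * UU m R w r = ∫ r in Ioo 0 R, ∫ s in Ioo 0 R, F r s := by
    apply setIntegral_congr_fun measurableSet_Ioo
    intro r hr
    simp only [F]
    unfold UU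
    rw [YY_eq _ _ _ hr.1.le]
    unfold kk
    rw [inner_toLp]
    simp_rw [mul_assoc]
    rw [integral_const_mul]
    have := hr.1
    field_simp
    ring
  have hRR : ∫ s in Ioo 0 R, (ee m s * Hh m R h s) * w s = ∫ s in Ioo 0 R, ∫ r in Ioo 0 R, F r s := by
    apply setIntegral_congr_fun measurableSet_Ioo
    intro s hs
    simp only [F]
    rw [integral_mul_const]
    congr 1
    unfold Hh
    rw [intervalIntegral.integral_of_le hs.2.le, ← integral_const_mul, integral_Ioc_eq_integral_Ioo,
      ← integral_Ico_eq_integral_Ioo, ← integral_indicator measurableSet_Ico, ← integral_indicator measurableSet_Ioo]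
    congr 1; ext r
    unfold ker
    by_cases h1 : r ∈ Ico s R
    · have h2 : r ∈ Ioo 0 R := ⟨hs.1.trans_le h1.1, h1.2⟩
      have h3 : s ∈ Ioc 0 r := ⟨hs.1, h1.1⟩
      rw [indicator_of_mem h1, indicator_of_mem h2, indicator_of_mem h3]; ring
    · rw [indicator_of_notMem h1]
      by_cases h2 : r ∈ Ioo 0 R
      · have h3 : s ∉ Ioc 0 r := fun h3 => h1 ⟨h3.2, h2.2⟩
        rw [indicator_of_mem h2, indicator_of_notMem h3]; ring
      · rw [indicator_of_notMem h2]
  rw [hL, hRR]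
  exact hswap

lemma span_of_orth {H : Type*} [NormedAddCommGroup H] [InnerProductSpace ℝ H] (k x : H)
    (h : ∀ w, ⟪k, w⟫_ℝ = 0 → ⟪x, w⟫_ℝ = 0) : ∃ C : ℝ, x = C • k := by
  by_cases hk : k = 0
  · refine ⟨0, ?_⟩
    have := h x (by rw [hk, inner_zero_left])
    rw [inner_self_eq_zero] at this
    simp [this]
  · have hk' : ⟪k, k⟫_ℝ ≠ 0 := by rwa [ne_eq, inner_self_eq_zero]
    refine ⟨⟪k, x⟫_ℝ / ⟪k, k⟫_ℝ, ?_⟩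
    set C := ⟪k, x⟫_ℝ / ⟪k, k⟫_ℝ with hC
    have h1 : ⟪k, x - C • k⟫_ℝ = 0 := by
      rw [inner_sub_right, inner_smul_right, hC]; field_simp; ring
    have h2 := h _ h1
    have h3 : ⟪x - C • k, x - C • k⟫_ℝ = 0 := by
      rw [inner_sub_left, h2, inner_smul_left, h1]; simp
    rw [inner_self_eq_zero, sub_eq_zero] at h3
    exact h3

lemma reg (m : ℕ) {R : ℝ} (hR : 0 < R) {g : ℝ → ℝ} (hgc : ContinuousOn g (Ioo 0 R)) {G : ℝ}
    (hgb : ∀ r ∈ Ioo 0 R, |g r| ≤ G)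
    (hpos : ∀ w : HH R, YY m R w R = 0 → 0 ≤ ‖w‖ ^ 2 + BB m R g w w)
    (f : HH R) (hf : YY m R f R = 0) (hf0 : ‖f‖ ^ 2 + BB m R g f f = 0) :
    ∃ Z : ℝ → ℝ, (∀ s ∈ Ioo 0 R, HasDerivAt Z (g s * UU m R f s / s ^ m) s) ∧
      (∀ s ∈ Ioo 0 R, HasDerivAt (YY m R f) (s ^ (2 * m + 1) * Z s) s) ∧
      ∃ B, ∀ s ∈ Ioo 0 R, |s ^ m * Z s| ≤ B := by
  set h : ℝ → ℝ := fun r => g r * UU m R f r with hh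
  have hc : ContinuousOn h (Ioo 0 R) := hgc.mul (UU_contOn' m R f)
  have hB : ∀ r ∈ Ioo 0 R, |h r| ≤ G * ‖f‖ := by
    intro r hr
    have h1 := hgb r hr
    have h2 := UU_bound m R f hr.1
    have : 0 ≤ G := (abs_nonneg _).trans h1
    rw [hh]; simp only
    rw [abs_mul]
    gcongr
  have hq := q_memLp m hc hB
  obtain ⟨C, hC⟩ := span_of_orth (kk m R R) (f + hq.toLp _) (by
    intro w hw
    rw [← YY_eq _ _ _ hR.le] at hw
    have h1 := EL m hR hgc hgb hpos f hf hf0 w hw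
    rw [inner_add_left, inner_toLp hq, ← fubini m hc hB w]
    have e : ∫ r in Ioo 0 R, r * h r * UU m R w r = BB m R g f w := by
      unfold BB
      congr 1; ext r; rw [hh]; ring
    rw [e, h1])
  have hae : ∀ᵐ s ∂(mu R), f s = ee m s * (C - Hh m R h s) := by
    have e1 : ((f : ℝ → ℝ) + ((hq.toLp _ : HH R) : ℝ → ℝ)) =ᵐ[mu R] ((C • kk m R R : HH R) : ℝ → ℝ) := by
      rw [← hC]; exact (Lp.coeFn_add _ _).symm
    filter_upwards [e1, hq.coeFn_toLp, Lp.coeFn_smul C (kk m R R), (ker_memLp m R R).coeFn_toLp,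
      ae_restrict_mem measurableSet_Ioo] with s h1 h2 h3 h4 h5
    rw [Pi.add_apply, h2, h3, Pi.smul_apply] at h1
    unfold kk at h1
    rw [h4] at h1
    unfold ker at h1
    rw [indicator_of_mem (Ioo_subset_Ioc_self h5), smul_eq_mul] at h1
    linarith
  let Z : ℝ → ℝ := fun s => C - Hh m R h s
  have hZd : ∀ s ∈ Ioo 0 R, HasDerivAt Z (g s * UU m R f s / s ^ m) s := by
    intro s hs
    have := (Hh_deriv m hc hB hs).const_sub C
    rw [neg_neg] at this
    exact this
  refine ⟨Z, hZd, ?_, ?_⟩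
  · intro s hs
    have hcont : ContinuousOn (fun t => t ^ (2 * m + 1) * Z t) (Ioo 0 R) := by
      intro t ht
      exact ((continuous_pow _).continuousAt.mul (hZd t ht).continuousAt).continuousWithinAt
    have hGG : ∀ᵐ t, t ∈ Ioo 0 R → GG m R f t = t ^ (2 * m + 1) * Z t := by
      rw [ae_restrict_iff' measurableSet_Ioo] at hae
      filter_upwards [hae] with t ht htm
      unfold GG
      rw [indicator_of_mem htm, ht htm, ← mul_assoc, ee_sq m htm.1.le]
    have hsub : ∀ x ∈ Ioo 0 R, ∀ t ∈ uIoc 0 x, t ∈ Ioo 0 R := by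
      intro x hx t ht
      rw [uIoc_of_le hx.1.le] at ht
      exact ⟨ht.1, ht.2.trans_lt hx.2⟩
    have heq : ∀ x ∈ Ioo 0 R, YY m R f x = ∫ t in (0:ℝ)..x, t ^ (2 * m + 1) * Z t := by
      intro x hx
      unfold YY
      apply intervalIntegral.integral_congr_ae
      filter_upwards [hGG] with t ht htx using ht (hsub x hx t htx)
    have hii : IntervalIntegrable (fun t => t ^ (2 * m + 1) * Z t) volume 0 s := by
      refine ((GG_int m R f).intervalIntegrable (a := 0) (b := s)).congr_ae ?_
      rw [Filter.EventuallyEq, ae_restrict_iff' measurableSet_uIoc]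
      filter_upwards [hGG] with t ht htx using ht (hsub s hs t htx)
    have hd := intervalIntegral.integral_hasDerivAt_right hii
      (hcont.stronglyMeasurableAtFilter isOpen_Ioo s hs) (hcont.continuousAt (isOpen_Ioo.mem_nhds hs))
    refine hd.congr_of_eventuallyEq ?_
    filter_upwards [isOpen_Ioo.mem_nhds hs] with x hx using heq x hx
  · refine ⟨R ^ m * |C| + G * ‖f‖ * R, fun s hs => ?_⟩
    have h1 := Hh_bd m hB hs
    have h2 := hs.1
    have h3 := hs.2
    calc |s ^ m * Z s| = |s ^ m * C - s ^ m * Hh m R h s| := by simp only [Z]; ring_nf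
      _ ≤ |s ^ m * C| + |s ^ m * Hh m R h s| := abs_sub _ _
      _ ≤ R ^ m * |C| + G * ‖f‖ * R := by
        gcongr
        rw [abs_mul, abs_of_pos (by positivity : 0 < s ^ m)]
        gcongr

lemma uniq (m : ℕ) {R : ℝ} {g : ℝ → ℝ} {G : ℝ}
    (hgb : ∀ r ∈ Ioo 0 R, |g r| ≤ G) (f : HH R) (Z : ℝ → ℝ)
    (hZ : ∀ s ∈ Ioo 0 R, HasDerivAt Z (g s * UU m R f s / s ^ m) s)
    (hY : ∀ s ∈ Ioo 0 R, HasDerivAt (YY m R f) (s ^ (2 * m + 1) * Z s) s)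
    {a b : ℝ} (ha : 0 ≤ a) (hab : a < b) (hb : b ≤ R) (h0 : ∀ r ∈ Ioo a b, YY m R f r = 0) :
    ∀ r ∈ Ioo 0 R, YY m R f r = 0 := by
  obtain ⟨t₀, ht₀⟩ := exists_between hab
  have ht0m : t₀ ∈ Ioo 0 R := ⟨ha.trans_lt ht₀.1, ht₀.2.trans_le hb⟩
  have hY0 : YY m R f t₀ = 0 := h0 t₀ ht₀
  have hZ0 : Z t₀ = 0 := by
    have h1 : HasDerivAt (YY m R f) 0 t₀ := by
      refine (hasDerivAt_const t₀ (0:ℝ)).congr_of_eventuallyEq ?_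
      filter_upwards [isOpen_Ioo.mem_nhds ht₀] with x hx using h0 x hx
    have h2 := h1.unique (hY t₀ ht0m)
    have : 0 < t₀ := ht0m.1
    have h3 : t₀ ^ (2 * m + 1) ≠ 0 := by positivity
    rcases mul_eq_zero.1 h2.symm with h | h
    · exact absurd h h3
    · exact h
  intro r hr
  obtain ⟨ε, hε0, hε⟩ : ∃ ε, 0 < ε ∧ ε < min r t₀ := exists_between (lt_min hr.1 ht0m.1)
  have hR0 : 0 < R := hr.1.trans hr.2
  have hG0 : 0 ≤ G := (abs_nonneg _).trans (hgb r hr)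
  let vf : ℝ → ℝ × ℝ → ℝ × ℝ := fun t p => (t ^ (2 * m + 1) * p.2, g t * p.1 / t ^ (2 * m + 1))
  let Kc : ℝ := max (R ^ (2 * m + 1)) (G / ε ^ (2 * m + 1))
  have hK0 : 0 ≤ Kc := le_max_of_le_left (by positivity)
  have hlip : ∀ t ∈ Ioo ε R, LipschitzOnWith ⟨Kc, hK0⟩ (vf t) univ := by
    intro t ht
    have htε := ht.1
    have htR := ht.2
    have ht0 : 0 < t := hε0.trans htε
    apply LipschitzOnWith.of_dist_le_mul
    intro p _ q _
    rw [Prod.dist_eq]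
    have hp1 : dist p.1 q.1 ≤ dist p q := le_max_left _ _
    have hp2 : dist p.2 q.2 ≤ dist p q := le_max_right _ _
    rw [Real.dist_eq] at hp1 hp2
    apply max_le
    · simp only [vf, Real.dist_eq]
      rw [← mul_sub, abs_mul, abs_of_pos (by positivity : 0 < t ^ (2 * m + 1))]
      have : t ^ (2 * m + 1) ≤ Kc := le_max_of_le_left (by gcongr)
      exact mul_le_mul this hp2 (abs_nonneg _) hK0
    · simp only [vf, Real.dist_eq]
      have e : g t * p.1 / t ^ (2 * m + 1) - g t * q.1 / t ^ (2 * m + 1) = g t / t ^ (2 * m + 1) * (p.1 - q.1) := by ring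
      rw [e, abs_mul, abs_div, abs_of_pos (by positivity : 0 < t ^ (2 * m + 1))]
      have hg := hgb t ⟨ht0, htR⟩
      have : |g t| / t ^ (2 * m + 1) ≤ Kc := le_max_of_le_right (by gcongr)
      exact mul_le_mul this hp1 (abs_nonneg _) hK0
  have := ODE_solution_unique_of_mem_Ioo (v := vf) (s := fun _ => univ) (a := ε) (b := R) (t₀ := t₀)
    (f := fun t => (YY m R f t, Z t)) (g := fun _ => (0, 0)) hlip
    ⟨hε.trans_le (min_le_right _ _), ht0m.2⟩
    (by
      intro t ht
      have ht0 : 0 < t := hε0.trans ht.1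
      refine ⟨?_, mem_univ _⟩
      have h1 := (hY t ⟨ht0, ht.2⟩).prodMk (hZ t ⟨ht0, ht.2⟩)
      convert! h1 using 1
      simp only [vf, UU, Prod.mk.injEq, true_and]
      field_simp
      ring)
    (by
      intro t ht
      refine ⟨?_, mem_univ _⟩
      have h1 := hasDerivAt_const t ((0:ℝ), (0:ℝ))
      convert! h1 using 1
      simp [vf])
    (by simp [hY0, hZ0])
  have h := this ⟨hε.trans_le (min_le_left _ _), hr.2⟩
  exact congrArg Prod.fst h

end Vtx

namespace Vtx
open scoped Topology InnerProductSpace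

lemma trunc (m : ℕ) {R : ℝ} (v : HH R) {r₀ : ℝ} (hr₀ : r₀ ∈ Ioo 0 R) (hz : YY m R v r₀ = 0) :
    ∃ w : HH R, (∀ r ∈ Icc 0 r₀, YY m R w r = YY m R v r) ∧ (∀ r, r₀ ≤ r → YY m R w r = 0) ∧
      ⟪w, v - w⟫_ℝ = 0 := by
  have hw : MemLp ((Ioc 0 r₀).indicator (v : ℝ → ℝ)) 2 (mu R) := (Lp.memLp v).indicator measurableSet_Ioc
  have hae : ∀ᵐ s, s ∈ Ioo 0 R → (hw.toLp _ : HH R) s = (Ioc 0 r₀).indicator (v : ℝ → ℝ) s := by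
    have := hw.coeFn_toLp
    rwa [Filter.EventuallyEq, ae_restrict_iff' measurableSet_Ioo] at this
  have hGG : ∀ᵐ s, GG m R (hw.toLp _) s = (Ioc 0 r₀).indicator (GG m R v) s := by
    filter_upwards [hae] with s hs
    unfold GG
    by_cases h1 : s ∈ Ioo 0 R
    · by_cases h2 : s ∈ Ioc 0 r₀
      · rw [indicator_of_mem h1, hs h1, indicator_of_mem h2, indicator_of_mem h2, indicator_of_mem h1]
      · rw [indicator_of_mem h1, hs h1, indicator_of_notMem h2, indicator_of_notMem h2, mul_zero]
    · rw [indicator_of_notMem h1]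
      by_cases h2 : s ∈ Ioc 0 r₀
      · rw [indicator_of_mem h2, indicator_of_notMem h1]
      · rw [indicator_of_notMem h2]
  have h1 : ∀ r ∈ Icc 0 r₀, YY m R (hw.toLp _) r = YY m R v r := by
    intro r hr
    unfold YY
    apply intervalIntegral.integral_congr_ae
    filter_upwards [hGG] with s hs hs2
    rw [uIoc_of_le hr.1] at hs2
    rw [hs, indicator_of_mem (show s ∈ Ioc 0 r₀ from ⟨hs2.1, hs2.2.trans hr.2⟩)]
  refine ⟨hw.toLp _, h1, ?_, ?_⟩
  · intro r hr
    have h2 : YY m R (hw.toLp _) r = YY m R (hw.toLp _) r₀ + ∫ s in r₀..r, GG m R (hw.toLp _) s := by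
      unfold YY
      rw [intervalIntegral.integral_add_adjacent_intervals]
      · exact (GG_int m R _).intervalIntegrable
      · exact (GG_int m R _).intervalIntegrable
    rw [h2, h1 r₀ ⟨hr₀.1.le, le_rfl⟩, hz, zero_add]
    apply intervalIntegral.integral_zero_ae
    filter_upwards [hGG] with s hs hs2
    rw [uIoc_of_le hr] at hs2
    rw [hs, indicator_of_notMem]
    intro h
    exact absurd h.2 (not_le.2 hs2.1)
  · rw [inner_eq]
    apply integral_eq_zero_of_ae
    filter_upwards [hw.coeFn_toLp, Lp.coeFn_sub v (hw.toLp _)] with s h1 h2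
    rw [h2, Pi.sub_apply, h1]
    by_cases h : s ∈ Ioc 0 r₀
    · rw [indicator_of_mem h]; simp
    · rw [indicator_of_notMem h]; simp

lemma nonvanish (m : ℕ) {R : ℝ} (hR : 0 < R) {g : ℝ → ℝ} (hgc : ContinuousOn g (Ioo 0 R)) {G : ℝ}
    (hgb : ∀ r ∈ Ioo 0 R, |g r| ≤ G)
    (hpos : ∀ w : HH R, YY m R w R = 0 → 0 ≤ ‖w‖ ^ 2 + BB m R g w w)
    (v : HH R) (hv : YY m R v R = 0) (hv0 : ‖v‖ ^ 2 + BB m R g v v = 0)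
    {r₀ : ℝ} (hr₀ : r₀ ∈ Ioo 0 R) (hz : YY m R v r₀ = 0) : ∀ r ∈ Ioo 0 R, YY m R v r = 0 := by
  obtain ⟨w, hw1, hw2, hw3⟩ := trunc m v hr₀ hz
  have hwR : YY m R w R = 0 := hw2 R hr₀.2.le
  have hvw : v = w + (1 : ℝ) • (v - w) := by simp
  have hYd : YY m R (v - w) R = 0 := by
    have := YY_add m R w (v - w) hR.le
    rw [add_sub_cancel, hv, hwR] at this
    linarith
  have hUU : BB m R g w (v - w) = 0 := by
    unfold BB
    apply setIntegral_eq_zero_of_forall_eq_zero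
    intro r hr
    have hadd := YY_add m R w (v - w) hr.1.le
    rw [add_sub_cancel] at hadd
    unfold UU
    rcases le_total r r₀ with h | h
    · rw [hw1 r ⟨hr.1.le, h⟩] at hadd
      have : YY m R (v - w) r = 0 := by linarith
      rw [this]; simp
    · rw [hw2 r h]; simp
  have hB := BB_expand m hgc hgb w (v - w) 1
  rw [← hvw, hUU] at hB
  have hN : ‖v‖ ^ 2 = ‖w‖ ^ 2 + ‖v - w‖ ^ 2 := by
    have := norm_add_sq_real w (v - w)
    rw [add_sub_cancel, hw3] at this
    linarith
  have h1 := hpos w hwR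
  have h2 := hpos (v - w) hYd
  have hw0 : ‖w‖ ^ 2 + BB m R g w w = 0 := by linarith
  obtain ⟨Z, hZ1, hZ2, -⟩ := reg m hR hgc hgb hpos w hwR hw0
  have hwz := uniq m hgb w Z hZ1 hZ2 hr₀.1.le hr₀.2 le_rfl (fun r hr => hw2 r hr.1.le)
  obtain ⟨Z', hZ1', hZ2', -⟩ := reg m hR hgc hgb hpos v hv hv0
  refine uniq m hgb v Z' hZ1' hZ2' le_rfl hr₀.1 hr₀.2.le (fun r hr => ?_)
  rw [← hw1 r (Ioo_subset_Icc_self hr)]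
  exact hwz r ⟨hr.1, hr.2.trans hr₀.2⟩

lemma core {α : ℝ} (hα : 0 < α) (n : ℤ) (m : ℕ) (hn : (n : ℝ) ^ 2 = ((m : ℝ) + 1) ^ 2)
    {R : ℝ} (hR : 0 < R) {c : ℝ} (hc : 0 < c) (v : HH R)
    (hv : YY m R v R = 0) (hvK : KK m R v = c)
    (hmin : ∀ w : HH R, YY m R w R = 0 → KK m R w = c → JJ α m R v ≤ JJ α m R w) :
    (∃ κ : ℝ, IsVortexSol α n κ R (UU m R v)) ∧ FiniteEnergy α R (UU m R v) ∧
      ∀ r ∈ Ioo 0 R, UU m R v r ≠ 0 := by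
  obtain ⟨μ, hv0, hpos⟩ := quad hα m hR hc v hvK hmin
  set g : ℝ → ℝ := fun r => PP α m R v r - μ with hg
  have hgc : ContinuousOn g (Ioo 0 R) := (PP_cont hα m R v).sub continuousOn_const
  have hgb : ∀ r ∈ Ioo 0 R, |g r| ≤ 2 / α + |μ| := by
    intro r _
    exact (abs_sub _ _).trans (by gcongr; exact PP_bd hα m R v r)
  obtain ⟨Z, hZ, hY, B, hB⟩ := reg m hR hgc hgb hpos v hv hv0
  set u := UU m R v with hu
  let D : ℝ → ℝ := fun r => r ^ m * Z r - (m + 1) * u r / r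
  have hD : ∀ r ∈ Ioo 0 R, HasDerivAt u (D r) r := by
    intro r hr
    have hr0 := hr.1
    have h1 := (hY r hr).div (hasDerivAt_pow (m + 1) r) (by positivity)
    have h2 : (r ^ (2 * m + 1) * Z r * r ^ (m + 1) - YY m R v r * (((m + 1 : ℕ) : ℝ) * r ^ (m + 1 - 1))) / (r ^ (m + 1)) ^ 2
        = D r := by
      simp only [D, hu, UU]
      push_cast
      field_simp
      ring
    rw [← h2]
    exact h1
  have hDd : ∀ r ∈ Ioo 0 R, HasDerivAt D
      ((m * r ^ (m - 1)) * Z r + r ^ m * (g r * u r / r ^ m) - ((m + 1) * D r * r - (m + 1) * u r * 1) / r ^ 2) r := by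
    intro r hr
    have hr0 := hr.1
    exact ((hasDerivAt_pow m r).mul (hZ r hr)).sub
      (((hD r hr).const_mul _).div (hasDerivAt_id r) hr0.ne')
  have hderiv : ∀ r ∈ Ioo 0 R, deriv u r = D r := fun r hr => (hD r hr).deriv
  have hev : ∀ r ∈ Ioo 0 R, deriv u =ᶠ[𝓝 r] D := by
    intro r hr
    filter_upwards [isOpen_Ioo.mem_nhds hr] with x hx using hderiv x hx
  have hrD : ∀ r ∈ Ioo 0 R, HasDerivAt (fun s => s * deriv u s) (r * g r * u r + (m + 1) ^ 2 * u r / r) r := by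
    intro r hr
    have hr0 := hr.1
    have h1 : HasDerivAt (fun s => s ^ (m + 1) * Z s - (m + 1) * u s)
        (((m + 1 : ℕ) : ℝ) * r ^ (m + 1 - 1) * Z r + r ^ (m + 1) * (g r * u r / r ^ m) - (m + 1) * D r) r :=
      ((hasDerivAt_pow (m + 1) r).mul (hZ r hr)).sub ((hD r hr).const_mul _)
    have h2 : ((m + 1 : ℕ) : ℝ) * r ^ (m + 1 - 1) * Z r + r ^ (m + 1) * (g r * u r / r ^ m) - (m + 1) * D r
        = r * g r * u r + (m + 1) ^ 2 * u r / r := by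
      simp only [D]
      push_cast
      field_simp
      ring
    rw [h2] at h1
    refine h1.congr_of_eventuallyEq ?_
    filter_upwards [isOpen_Ioo.mem_nhds hr] with x hx
    rw [hderiv x hx]
    have := hx.1
    simp only [D]
    field_simp
    ring
  have hubd : ∀ r ∈ Ioo 0 R, |u r| ≤ B * r := by
    intro r hr
    have hr0 := hr.1
    obtain ⟨s, hs, hs2⟩ := exists_hasDerivAt_eq_slope (YY m R v) (fun s => s ^ (2 * m + 1) * Z s) hr0
      (YY_cont m R v).continuousOn (fun x hx => hY x ⟨hx.1, hx.2.trans hr.2⟩)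
    rw [YY_zero, sub_zero, sub_zero, eq_div_iff hr0.ne'] at hs2
    have hs0 := hs.1
    have hsr := hs.2
    have hb := hB s ⟨hs0, hsr.trans hr.2⟩
    have hB0 : 0 ≤ B := (abs_nonneg _).trans hb
    rw [hu]; unfold UU
    rw [← hs2, abs_div, abs_of_pos (by positivity : 0 < r ^ (m + 1)), div_le_iff₀ (by positivity),
      show s ^ (2 * m + 1) * Z s * r = s ^ (m + 1) * (s ^ m * Z s) * r by ring, abs_mul, abs_mul,
      abs_of_pos hr0, abs_of_pos (by positivity : 0 < s ^ (m + 1))]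
    calc s ^ (m + 1) * |s ^ m * Z s| * r ≤ r ^ (m + 1) * B * r := by gcongr
      _ = _ := by ring
  have hB0 : 0 ≤ B := (abs_nonneg _).trans (hB (R / 2) ⟨by linarith, by linarith⟩)
  have hu0 : u 0 = 0 := by simp [hu, UU]
  refine ⟨⟨1 / α - μ / 2, ?_, ?_, hu0, ?_, ?_⟩, ?_, ?_⟩
  · intro r hr
    rcases hr.1.eq_or_lt with h | h
    · rw [← h]
      rw [ContinuousWithinAt, hu0]
      have hlim : Tendsto (fun r : ℝ => B * r) (𝓝[Icc 0 R] 0) (𝓝 0) := by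
        have : Tendsto (fun r : ℝ => B * r) (𝓝 0) (𝓝 (B * 0)) := (continuous_const.mul continuous_id).tendsto 0
        rw [mul_zero] at this
        exact this.mono_left nhdsWithin_le_nhds
      refine squeeze_zero_norm' ?_ hlim
      have hlt : ∀ᶠ x in 𝓝[Icc 0 R] (0:ℝ), x < R :=
        (isOpen_Iio.mem_nhds hR : Iio R ∈ 𝓝 (0:ℝ)) |> mem_nhdsWithin_of_mem_nhds
      filter_upwards [self_mem_nhdsWithin, hlt] with x hx hxR
      rcases hx.1.eq_or_lt with h' | h'
      · rw [← h', hu0]; simp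
      · exact hubd x ⟨h', hxR⟩
    · exact ((UU_contOn m R v).continuousAt (isOpen_Ioi.mem_nhds h)).continuousWithinAt
  · intro r hr
    exact ⟨(hD r hr).differentiableAt, ((hDd r hr).congr_of_eventuallyEq (hev r hr)).differentiableAt⟩
  · rw [hu]; unfold UU; rw [hv, zero_div]
  · intro r hr
    have hr0 := hr.1
    rw [(hrD r hr).deriv, hn]
    simp only [hg, PP]
    rw [← hu]
    have : 0 < 1 + α * u r ^ 2 := by positivity
    field_simp
    ring
  · have hDc : ContinuousOn D (Ioo 0 R) := fun r hr => (hDd r hr).continuousAt.continuousWithinAt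
    have huc : ContinuousOn u (Ioo 0 R) := UU_contOn' m R v
    have hq : ∀ r ∈ Ioo 0 R, |u r / r| ≤ B := by
      intro r hr
      have := hr.1
      rw [abs_div, abs_of_pos hr.1, div_le_iff₀ hr.1]; exact hubd r hr
    have hDb : ∀ r ∈ Ioo 0 R, |D r| ≤ B + (m + 1) * B := by
      intro r hr
      simp only [D]
      refine (abs_sub _ _).trans (add_le_add (hB r hr) ?_)
      rw [mul_div_assoc, abs_mul, abs_of_pos (by positivity : (0:ℝ) < m + 1)]
      have := hq r hr
      gcongr
    have i1 : IntegrableOn (fun r => r * D r ^ 2) (Ioo 0 R) := by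
      refine bdd_int (by fun_prop) (R * (B + (m + 1) * B) ^ 2) ?_
      intro r hr
      have h1 := hDb r hr
      have h2 := hr.1
      have h3 := hr.2
      rw [abs_mul, abs_pow, abs_of_pos h2]
      gcongr
    have i2 : IntegrableOn (fun r => u r ^ 2 / r) (Ioo 0 R) := by
      refine bdd_int ?_ (R * B ^ 2) ?_
      · exact ContinuousOn.div (by fun_prop) (by fun_prop) (fun x hx => hx.1.ne')
      · intro r hr
        have h1 := hq r hr
        have h2 := hr.1
        have h3 := hr.2
        have e : u r ^ 2 / r = r * (u r / r) ^ 2 := by field_simp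
        rw [e, abs_mul, abs_pow, abs_of_pos h2]
        gcongr
    have i3 := L_int hα m R v
    have := (i1.add i2).add i3
    refine this.congr_fun ?_ measurableSet_Ioo
    intro r hr
    simp only [Pi.add_apply]
    rw [hderiv r hr]
  · intro r hr h0
    have hY0 : YY m R v r = 0 := by
      rw [hu] at h0
      unfold UU at h0
      have := hr.1
      rcases div_eq_zero_iff.1 h0 with h | h
      · exact h
      · exact absurd h (by positivity)
    have hall := nonvanish m hR hgc hgb hpos v hv hv0 hr hY0
    have : KK m R v = 0 := by
      unfold KK
      apply setIntegral_eq_zero_of_forall_eq_zero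
      intro s hs
      unfold UU
      rw [hall s hs]; simp
    linarith

lemma exists_min_pos {α : ℝ} (hα : 0 < α) (m : ℕ) {R : ℝ} (hR : 0 < R) {c : ℝ} (hc : 0 < c) :
    ∃ v : HH R, YY m R v R = 0 ∧ KK m R v = c ∧ 0 ≤ UU m R v (R / 2) ∧
      ∀ w : HH R, YY m R w R = 0 → KK m R w = c → JJ α m R v ≤ JJ α m R w := by
  obtain ⟨v, h1, h2, h3⟩ := exists_min hα m hR hc
  rcases le_total 0 (UU m R v (R / 2)) with h | h
  · exact ⟨v, h1, h2, h, h3⟩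
  · refine ⟨(-1 : ℝ) • v, ?_, ?_, ?_, fun w hw1 hw2 => ?_⟩
    · rw [YY_smul _ _ _ _ hR.le, h1, mul_zero]
    · rw [KK_smul, h2]; ring
    · rw [UU_smul _ _ _ _ (by positivity)]; linarith
    · have e : JJ α m R ((-1 : ℝ) • v) = JJ α m R v := by
        unfold JJ
        congr 1
        · rw [norm_smul]; simp
        · congr 1
          unfold LL
          apply setIntegral_congr_fun measurableSet_Ioo
          intro r hr
          simp only
          rw [UU_smul _ _ _ _ hr.1.le]
          congr 3
          ring
      rw [e]; exact h3 w hw1 hw2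

end Vtx

/-- existence of a positive solution with prescribed energy flux. -/
theorem stmt5 (α : ℝ) (hα : 0 < α) (n : ℤ) (hn : 1 ≤ |n|) (R : ℝ) (hR : 0 < R)
    (Q₀ : ℝ) (hQ : 0 < Q₀) :
    ∃ κ : ℝ, ∃ u : ℝ → ℝ, IsVortexSol α n κ R u ∧ FiniteEnergy α R u ∧
      (∀ r ∈ Ioo (0 : ℝ) R, 0 < u r) ∧ fluxQ R u = Q₀ := by
  obtain ⟨m, hm⟩ : ∃ m : ℕ, |n| = (m : ℤ) + 1 := ⟨(|n| - 1).toNat, by omega⟩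
  have hn2 : (n : ℝ) ^ 2 = ((m : ℝ) + 1) ^ 2 := by
    have h1 : n ^ 2 = ((m : ℤ) + 1) ^ 2 := by rw [← hm, sq_abs]
    exact_mod_cast h1
  have hc : 0 < Q₀ / (2 * Real.pi) := by positivity
  obtain ⟨v, h1, h2, h3, h4⟩ := Vtx.exists_min_pos hα m hR hc
  obtain ⟨⟨κ, hs⟩, hE, hne⟩ := Vtx.core hα n m hn2 hR hc v h1 h2 h4
  refine ⟨κ, Vtx.UU m R v, hs, hE, ?_, ?_⟩
  · intro r hr
    by_contra hcon
    push Not at hcon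
    have hmid : R / 2 ∈ Ioo 0 R := ⟨by linarith, by linarith⟩
    obtain ⟨x, hx, hx0⟩ := isPreconnected_Ioo.intermediate_value hr hmid
      (Vtx.UU_contOn' m R v) (show (0:ℝ) ∈ Icc _ _ from ⟨hcon, h3⟩)
    exact hne x hx hx0
  · unfold fluxQ
    have : ∫ r in Ioo (0 : ℝ) R, r * (Vtx.UU m R v r) ^ 2 = Q₀ / (2 * Real.pi) := h2
    rw [this]
    have := Real.pi_pos
    field_simp
end

section
/- Let u be a classical solution of the n-vortex equation with finite energy such that n² + 2 r² κ > 0 for all r ∈ (0,R] and Q(u) ≤ 1/4. Then u is identically zero on [0,R]. -/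
open MeasureTheory Set Filter

/-- nonexistence of nontrivial small-energy-flux solutions. -/
theorem stmt6 (α : ℝ) (hα : 0 < α) (n : ℤ) (hn : 1 ≤ |n|) (κ R : ℝ) (hR : 0 < R)
    (u : ℝ → ℝ) (hu : IsVortexSol α n κ R u) (hE : FiniteEnergy α R u)
    (hpos : ∀ r ∈ Ioc (0 : ℝ) R, 0 < (n : ℝ) ^ 2 + 2 * r ^ 2 * κ)
    (hQ : fluxQ R u ≤ 1 / 4) :
    ∀ r ∈ Icc (0 : ℝ) R, u r = 0 := by
  obtain ⟨hc, hd, hu0, huR, hode⟩ := hu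
  have hdu : ∀ r ∈ Ioo (0 : ℝ) R, HasDerivAt u (deriv u r) r := fun r hr => (hd r hr).1.hasDerivAt
  have hIoc : ∀ {f : ℝ → ℝ}, IntegrableOn f (Ioo 0 R) → IntervalIntegrable f volume 0 R := by
    intro f hf
    exact (intervalIntegrable_iff_integrableOn_Ioo_of_le hR.le).2 hf
  have hcI : ∀ {f : ℝ → ℝ}, ContinuousOn f (Icc 0 R) → IntervalIntegrable f volume 0 R := by
    intro f hf
    exact ContinuousOn.intervalIntegrable_of_Icc hR.le hf
  have hcoo : ContinuousOn u (Ioo 0 R) := hc.mono Ioo_subset_Icc_self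
  -- integrability
  have hnl : ∀ r ∈ Ioo (0 : ℝ) R, 0 ≤ r * Real.log (1 + α * (u r) ^ 2) := by
    intro r hr
    apply mul_nonneg hr.1.le
    apply Real.log_nonneg
    nlinarith [mul_nonneg hα.le (sq_nonneg (u r))]
  have hn2 : ∀ r ∈ Ioo (0 : ℝ) R, 0 ≤ (u r) ^ 2 / r := fun r hr =>
    div_nonneg (sq_nonneg _) hr.1.le
  have hn1 : ∀ r ∈ Ioo (0 : ℝ) R, 0 ≤ r * (deriv u r) ^ 2 := fun r hr =>
    mul_nonneg hr.1.le (sq_nonneg _)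
  have hB : IntervalIntegrable (fun r => r * (deriv u r) ^ 2) volume 0 R := by
    apply hIoc
    refine Integrable.mono' hE ?_ ?_
    · exact (measurable_id.mul ((measurable_deriv u).pow_const 2)).aestronglyMeasurable
    · refine (ae_restrict_iff' measurableSet_Ioo).2 (ae_of_all _ fun r hr => ?_)
      rw [Real.norm_of_nonneg (hn1 r hr)]
      linarith [hn1 r hr, hn2 r hr, hnl r hr]
  have hD : IntervalIntegrable (fun r => (u r) ^ 2 / r) volume 0 R := by
    apply hIoc
    refine Integrable.mono' hE ?_ ?_
    · refine ContinuousOn.aestronglyMeasurable ?_ measurableSet_Ioo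
      exact (hcoo.pow 2).div continuousOn_id (fun r hr => hr.1.ne')
    · refine (ae_restrict_iff' measurableSet_Ioo).2 (ae_of_all _ fun r hr => ?_)
      rw [Real.norm_of_nonneg (hn2 r hr)]
      linarith [hn1 r hr, hn2 r hr, hnl r hr]
  have hA : ContinuousOn (fun r => r * (u r) ^ 2) (Icc 0 R) := continuousOn_id.mul (hc.pow 2)
  have hX : ContinuousOn (fun r => r * (u r) ^ 4) (Icc 0 R) := continuousOn_id.mul (hc.pow 4)
  have hS : ContinuousOn (fun r => 2 * r * (u r) ^ 4 / (1 + α * (u r) ^ 2)) (Icc 0 R) := by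
    refine ((continuousOn_const.mul continuousOn_id).mul (hc.pow 4)).div
      (continuousOn_const.add (continuousOn_const.mul (hc.pow 2))) ?_
    intro r _
    have := mul_nonneg hα.le (sq_nonneg (u r))
    positivity
  -- the flux bound
  have hQ' : ∫ r in (0 : ℝ)..R, r * (u r) ^ 2 ≤ 1 / 24 := by
    rw [intervalIntegral.integral_of_le hR.le, integral_Ioc_eq_integral_Ioo]
    unfold fluxQ at hQ
    have hp := Real.pi_gt_three
    have h0 : 0 ≤ ∫ r in Ioo (0 : ℝ) R, r * (u r) ^ 2 :=
      setIntegral_nonneg measurableSet_Ioo fun r hr => mul_nonneg hr.1.le (sq_nonneg _)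
    nlinarith
  -- energy inequality
  set g : ℝ → ℝ := fun r => r * (deriv u r) ^ 2 + ((n : ℝ) ^ 2 * ((u r) ^ 2 / r)
      + 2 * κ * (r * (u r) ^ 2)) - 2 * r * (u r) ^ 4 / (1 + α * (u r) ^ 2) with hg
  have hgi : IntervalIntegrable g volume 0 R :=
    (hB.add ((hD.const_mul _).add ((hcI hA).const_mul _))).sub (hcI hS)
  have hG : ∀ r ∈ Ioo (0 : ℝ) R, HasDerivAt (fun s => s * deriv u s * u s) (g r) r := by
    intro r hr
    have h1 : HasDerivAt (fun s => s * deriv u s) (deriv (fun s => s * deriv u s) r) r :=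
      (differentiableAt_id.mul (hd r hr).2).hasDerivAt
    have h2 := h1.mul (hdu r hr)
    refine h2.congr_deriv ?_
    have h3 := hode r hr
    have hr0 : r ≠ 0 := hr.1.ne'
    have h4 : 1 + α * (u r) ^ 2 ≠ 0 := by
      have := mul_nonneg hα.le (sq_nonneg (u r))
      positivity
    have h5 : deriv (fun s => s * deriv u s) r = ((n : ℝ) ^ 2 / r) * u r
      - 2 * r * (u r) ^ 3 / (1 + α * (u r) ^ 2) + 2 * κ * r * u r := by linarith
    rw [h5, hg]
    ring
  have hen : ∫ r in (0 : ℝ)..R, g r ≤ 0 := by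
    by_contra hcon
    push Not at hcon
    have hIc : ContinuousOn (fun x => ∫ r in (0 : ℝ)..x, g r) (Icc 0 R) := by
      have := intervalIntegral.continuousOn_primitive_interval' hgi left_mem_uIcc
      rwa [uIcc_of_le hR.le] at this
    set J := ∫ r in (0 : ℝ)..R, g r with hJ
    have hsq : ContinuousOn (fun r => (u r) ^ 2) (Icc 0 R) := hc.pow 2
    have hsd : ∀ r ∈ Ioo (0 : ℝ) R, HasDerivAt (fun r => (u r) ^ 2) (2 * u r * deriv u r) r := by
      intro r hr
      exact ((hdu r hr).pow 2).congr_deriv (by simp)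
    obtain ⟨d, hd0, hdR⟩ := (Metric.continuousOn_iff.1 hIc) 0 ⟨le_rfl, hR.le⟩ (J / 3) (by positivity)
    obtain ⟨e, he0, heR⟩ := (Metric.continuousOn_iff.1 hIc) R ⟨hR.le, le_rfl⟩ (J / 3) (by positivity)
    have hm1 : 0 < min d (R / 2) := by positivity
    have hm2 : 0 < min e (R / 2) := by positivity
    have l1 := min_le_left d (R / 2)
    have l2 := min_le_right d (R / 2)
    have l3 := min_le_left e (R / 2)
    have l4 := min_le_right e (R / 2)
    obtain ⟨a, ha, hae⟩ := exists_hasDerivAt_eq_slope (fun r => (u r) ^ 2)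
      (fun r => 2 * u r * deriv u r) hm1
      (hsq.mono (Icc_subset_Icc le_rfl (by linarith)))
      (fun r hr => hsd r ⟨hr.1, by linarith [hr.2]⟩)
    obtain ⟨b, hb, hbe⟩ := exists_hasDerivAt_eq_slope (fun r => (u r) ^ 2)
      (fun r => 2 * u r * deriv u r) (show R - min e (R / 2) < R by linarith)
      (hsq.mono (Icc_subset_Icc (by linarith) le_rfl))
      (fun r hr => hsd r ⟨by linarith [hr.1], hr.2⟩)
    have ha0 : 0 ≤ 2 * u a * deriv u a := by
      rw [hae, hu0]
      apply div_nonneg <;> nlinarith [sq_nonneg (u (min d (R / 2)))]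
    have hb0 : 2 * u b * deriv u b ≤ 0 := by
      rw [hbe, huR]
      apply div_nonpos_of_nonpos_of_nonneg <;> nlinarith [sq_nonneg (u (R - min e (R / 2)))]
    have hab : a ≤ b := by linarith [ha.2, hb.1]
    have haR : a ∈ Icc 0 R := ⟨ha.1.le, by linarith [ha.2]⟩
    have hbR : b ∈ Icc 0 R := ⟨by linarith [hb.1], hb.2.le⟩
    have q1 := hdR a haR (by rw [Real.dist_eq, sub_zero, abs_of_pos ha.1]; linarith [ha.2])
    have q2 := heR b hbR (by rw [Real.dist_eq, abs_of_neg (by linarith [hb.2])]; linarith [hb.1])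
    rw [Real.dist_eq] at q1 q2
    simp only [intervalIntegral.integral_same, sub_zero] at q1
    have i1 : IntervalIntegrable g volume 0 a := hgi.mono_set (by
      rw [uIcc_of_le hR.le, uIcc_of_le haR.1]; exact Icc_subset_Icc le_rfl haR.2)
    have i2 : IntervalIntegrable g volume a b := hgi.mono_set (by
      rw [uIcc_of_le hR.le, uIcc_of_le hab]; exact Icc_subset_Icc haR.1 hbR.2)
    have hadd := intervalIntegral.integral_add_adjacent_intervals i1 i2
    have hftc := intervalIntegral.integral_eq_sub_of_hasDerivAt (f := fun s => s * deriv u s * u s)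
      (f' := g) (a := a) (b := b) (by
        intro x hx
        rw [uIcc_of_le hab] at hx
        exact hG x ⟨by linarith [hx.1, ha.1], by linarith [hx.2, hb.2]⟩) i2
    have w1 : 0 ≤ a * deriv u a * u a := by nlinarith [mul_nonneg haR.1 ha0]
    have w2 : b * deriv u b * u b ≤ 0 := by nlinarith [mul_nonneg hbR.1 (neg_nonneg.2 hb0)]
    have := (abs_lt.1 q1).2
    have := (abs_lt.1 q2).1
    linarith
  -- the function F
  set F : ℝ → ℝ := fun r => ∫ s in (0 : ℝ)..r, s * (u s) ^ 2 with hF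
  set X : ℝ := ∫ r in (0 : ℝ)..R, r * (u r) ^ 4 with hXd
  set A : ℝ := ∫ r in (0 : ℝ)..R, r * (u r) ^ 2 with hAd
  set B : ℝ := ∫ r in (0 : ℝ)..R, r * (deriv u r) ^ 2 with hBd
  have hFc : ContinuousOn F (Icc 0 R) := by
    have := intervalIntegral.continuousOn_primitive_interval' (hcI hA) left_mem_uIcc
    rwa [uIcc_of_le hR.le] at this
  have hsub : ∀ {f : ℝ → ℝ}, ContinuousOn f (Icc 0 R) → ∀ r ∈ Ioo (0 : ℝ) R,
      IntervalIntegrable f volume 0 r := fun hf r hr =>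
    ContinuousOn.intervalIntegrable_of_Icc hr.1.le (hf.mono (Icc_subset_Icc le_rfl hr.2.le))
  have hFd : ∀ r ∈ Ioo (0 : ℝ) R, HasDerivAt F (r * (u r) ^ 2) r := by
    intro r hr
    have hAo : ContinuousOn (fun r => r * (u r) ^ 2) (Ioo 0 R) := hA.mono Ioo_subset_Icc_self
    exact intervalIntegral.integral_hasDerivAt_right (hsub hA r hr)
      (hAo.stronglyMeasurableAtFilter isOpen_Ioo r hr)
      (hAo.continuousAt (isOpen_Ioo.mem_nhds hr))
  have hX0 : 0 ≤ X := intervalIntegral.integral_nonneg hR.le fun r hr =>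
    mul_nonneg hr.1 (by positivity)
  have hB0 : 0 ≤ B := intervalIntegral.integral_nonneg hR.le fun r hr =>
    mul_nonneg hr.1 (by positivity)
  have hFX : ∀ r ∈ Ioo (0 : ℝ) R, 2 * F r ^ 2 ≤ X * r ^ 2 := by
    intro r hr
    have hr0 := hr.1
    have hXr : ∫ s in (0 : ℝ)..r, s * (u s) ^ 4 ≤ X := by
      apply intervalIntegral.integral_mono_interval le_rfl hr.1.le hr.2.le _ (hcI hX)
      refine (ae_restrict_iff' measurableSet_Ioc).2 (ae_of_all _ fun s hs => ?_)
      exact mul_nonneg hs.1.le (by positivity)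
    have key : ∀ t : ℝ, 0 ≤ (∫ s in (0 : ℝ)..r, s * (u s) ^ 4) - 2 * t * F r + t ^ 2 * (r ^ 2 / 2) := by
      intro t
      have h1 : 0 ≤ ∫ s in (0 : ℝ)..r, (s * (u s) ^ 4 - 2 * t * (s * (u s) ^ 2) + t ^ 2 * s) := by
        apply intervalIntegral.integral_nonneg hr.1.le
        intro s hs
        have : s * (u s) ^ 4 - 2 * t * (s * (u s) ^ 2) + t ^ 2 * s = s * ((u s) ^ 2 - t) ^ 2 := by ring
        rw [this]
        exact mul_nonneg hs.1 (sq_nonneg _)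
      rw [intervalIntegral.integral_add ((hsub hX r hr).sub ((hsub hA r hr).const_mul _))
        ((intervalIntegral.intervalIntegrable_id).const_mul _),
        intervalIntegral.integral_sub (hsub hX r hr) ((hsub hA r hr).const_mul _),
        intervalIntegral.integral_const_mul, intervalIntegral.integral_const_mul, integral_id] at h1
      simpa using h1
    have h2 := key (2 * F r / r ^ 2)
    have h3 : (2 * F r / r ^ 2) ^ 2 * (r ^ 2 / 2) = 2 * F r ^ 2 / r ^ 2 := by
      field_simp
    have h4 : 2 * (2 * F r / r ^ 2) * F r = 2 * (2 * F r ^ 2 / r ^ 2) := by ring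
    rw [h3, h4] at h2
    have h5 : 2 * F r ^ 2 / r ^ 2 ≤ X := by linarith
    rwa [div_le_iff₀ (by positivity)] at h5
  have hXB : X ≤ B / 12 := by
    have hpt : ∀ r ∈ Ioo (0 : ℝ) R, -(2 * F r * (u r * deriv u r)) ≤
        12 * X * (r * (u r) ^ 2) + 1 / 24 * (r * (deriv u r) ^ 2) := by
      intro r hr
      have hr0 := hr.1
      have h1 := hFX r hr
      have h2 : 24 * (F r ^ 2 * (u r) ^ 2) ≤ 12 * X * r ^ 2 * (u r) ^ 2 := by
        nlinarith [mul_le_mul_of_nonneg_right h1 (sq_nonneg (u r))]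
      have h3 : -(2 * F r * (u r * deriv u r)) * r ≤
        (12 * X * (r * (u r) ^ 2) + 1 / 24 * (r * (deriv u r) ^ 2)) * r := by
        nlinarith [sq_nonneg (24 * (F r * u r) + r * deriv u r)]
      exact le_of_mul_le_mul_right h3 hr0
    have hm : AEStronglyMeasurable (fun r => u r * deriv u r) (volume.restrict (Ioo 0 R)) :=
      (hcoo.aestronglyMeasurable measurableSet_Ioo).mul (measurable_deriv u).aestronglyMeasurable
    have huu : IntervalIntegrable (fun r => u r * deriv u r) volume 0 R := by
      apply hIoc
      refine Integrable.mono' hE hm ?_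
      refine (ae_restrict_iff' measurableSet_Ioo).2 (ae_of_all _ fun r hr => ?_)
      have hr0 := hr.1
      have h0 : |u r * deriv u r| ≤ r * (deriv u r) ^ 2 + (u r) ^ 2 / r := by
        have e1 : |u r * deriv u r| * r ≤ (r * (deriv u r) ^ 2 + (u r) ^ 2 / r) * r := by
          rw [add_mul, div_mul_cancel₀ _ hr0.ne', abs_mul, ← sq_abs (u r), ← sq_abs (deriv u r)]
          nlinarith [sq_nonneg (r * |deriv u r| - |u r|), sq_nonneg (|u r|),
            sq_nonneg (r * |deriv u r|)]
        exact le_of_mul_le_mul_right e1 hr0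
      rw [Real.norm_eq_abs]
      linarith [hnl r hr]
    have hFu : IntervalIntegrable (fun r => 2 * F r * (u r * deriv u r)) volume 0 R := by
      apply IntervalIntegrable.continuousOn_mul huu
      rw [uIcc_of_le hR.le]
      exact continuousOn_const.mul hFc
    have hftc := intervalIntegral.integral_eq_sub_of_hasDerivAt_of_le hR.le
      (f := fun r => F r * (u r) ^ 2)
      (f' := fun r => r * (u r) ^ 4 + 2 * F r * (u r * deriv u r))
      (hFc.mul (hc.pow 2)) (by
        intro r hr
        refine ((hFd r hr).mul ((hdu r hr).pow 2)).congr_deriv ?_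
        simp
        ring) ((hcI hX).add hFu)
    rw [intervalIntegral.integral_add (hcI hX) hFu] at hftc
    simp only [hu0, huR] at hftc
    have hmono : ∫ r in (0 : ℝ)..R, -(2 * F r * (u r * deriv u r)) ≤
        ∫ r in (0 : ℝ)..R, (12 * X * (r * (u r) ^ 2) + 1 / 24 * (r * (deriv u r) ^ 2)) :=
      intervalIntegral.integral_mono_on_of_le_Ioo hR.le hFu.neg
        (((hcI hA).const_mul _).add (hB.const_mul _)) hpt
    rw [intervalIntegral.integral_add ((hcI hA).const_mul _) (hB.const_mul _),
      intervalIntegral.integral_const_mul, intervalIntegral.integral_const_mul,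
      intervalIntegral.integral_neg] at hmono
    have : 12 * X * A ≤ 12 * X * (1 / 24) := mul_le_mul_of_nonneg_left hQ' (by positivity)
    change X + _ = _ at hftc
    change _ ≤ 12 * X * A + 1 / 24 * B at hmono
    linarith
  have hBX : B ≤ 2 * X := by
    have hmono : ∫ r in (0 : ℝ)..R, (r * (deriv u r) ^ 2 - 2 * (r * (u r) ^ 4)) ≤
        ∫ r in (0 : ℝ)..R, g r := by
      refine intervalIntegral.integral_mono_on_of_le_Ioo hR.le (hB.sub ((hcI hX).const_mul _)) hgi ?_
      intro r hr
      have hr0 := hr.1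
      have h1 : 0 ≤ (n : ℝ) ^ 2 * ((u r) ^ 2 / r) + 2 * κ * (r * (u r) ^ 2) := by
        have : (n : ℝ) ^ 2 * ((u r) ^ 2 / r) + 2 * κ * (r * (u r) ^ 2)
          = ((n : ℝ) ^ 2 + 2 * r ^ 2 * κ) * ((u r) ^ 2 / r) := by
          field_simp
        rw [this]
        exact mul_nonneg (hpos r ⟨hr.1, hr.2.le⟩).le (hn2 r hr)
      have h2 : 2 * r * (u r) ^ 4 / (1 + α * (u r) ^ 2) ≤ 2 * r * (u r) ^ 4 := by
        apply div_le_self (by positivity)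
        linarith [mul_nonneg hα.le (sq_nonneg (u r))]
      simp only [hg]
      linarith
    rw [intervalIntegral.integral_sub hB ((hcI hX).const_mul _),
      intervalIntegral.integral_const_mul] at hmono
    change B - 2 * X ≤ _ at hmono
    linarith
  have hXz : X = 0 := by linarith
  have hFz : ∀ r ∈ Ioo (0 : ℝ) R, F r = 0 := by
    intro r hr
    have := hFX r hr
    rw [hXz] at this
    nlinarith [sq_nonneg (F r)]
  intro r hr
  rcases eq_or_lt_of_le hr.1 with h | h
  · rw [← h, hu0]
  rcases eq_or_lt_of_le hr.2 with h' | h'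
  · rw [h', huR]
  have hev : F =ᶠ[nhds r] fun _ => 0 := by
    filter_upwards [isOpen_Ioo.mem_nhds (show r ∈ Ioo 0 R from ⟨h, h'⟩)] with s hs
    exact hFz s hs
  have h1 := (hFd r ⟨h, h'⟩).unique ((hasDerivAt_const r (0 : ℝ)).congr_of_eventuallyEq hev)
  have h2 := (mul_eq_zero.1 h1).resolve_left h.ne'
  exact pow_eq_zero_iff (two_ne_zero) |>.1 h2
end

section
/- Let Q₀ > 0 and let (u, κ) be such that u is a classical solution of the n-vortex equation with finite energy, Q(u) = Q₀, and u minimizes the action over the admissible class subject to the flux constraint, i.e. 𝓘(u) ≤ 𝓘(v) for every v ∈ 𝒜 with Q(v) = Q₀. Then κ ≥ α⁻¹ − (6/R²)(1 + n²(2 ln 2 − 1)) − (π R²/(α² Q₀)) [ ln(1 + 3 α Q₀/(π R²)) − 2 + ( 4 π R²/(3 α Q₀) )^{1/2} arctan( ( 3 α Q₀/(π R²) )^{1/2} ) ]. -/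
open MeasureTheory Set Filter

lemma fold_integral {a : ℝ} (ha : 0 < a) {f g₁ g₂ : ℝ → ℝ}
    (h₁ : ContinuousOn g₁ (Icc 0 a)) (h₂ : ContinuousOn g₂ (Icc 0 a))
    (e₁ : ∀ r ∈ Ioo 0 a, f r = g₁ r) (e₂ : ∀ r ∈ Ioo 0 a, f (2 * a - r) = g₂ r) :
    IntegrableOn f (Ioo 0 (2 * a)) ∧
      ∫ r in Ioo 0 (2 * a), f r = ∫ r in (0 : ℝ)..a, (g₁ r + g₂ r) := by
  have i₁ : IntervalIntegrable g₁ volume 0 a := by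
    apply ContinuousOn.intervalIntegrable; rwa [uIcc_of_le ha.le]
  have i₂ : IntervalIntegrable g₂ volume 0 a := by
    apply ContinuousOn.intervalIntegrable; rwa [uIcc_of_le ha.le]
  have j₁ : IntervalIntegrable f volume 0 a := by
    apply i₁.congr_uIoo
    rw [uIoo_of_le ha.le]
    exact fun r hr => (e₁ r hr).symm
  have j₂' : IntervalIntegrable (fun r => f (2 * a - r)) volume 0 a := by
    apply i₂.congr_uIoo
    rw [uIoo_of_le ha.le]
    exact fun r hr => (e₂ r hr).symm
  have j₂ : IntervalIntegrable f volume a (2 * a) := by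
    have := (j₂'.comp_sub_left (2 * a)).symm
    have e : 2 * a - a = a := by ring
    simpa [e] using this
  have k₁ : ∫ r in (0 : ℝ)..a, f r = ∫ r in (0 : ℝ)..a, g₁ r := by
    apply intervalIntegral.integral_congr_uIoo
    rw [uIoo_of_le ha.le]; exact e₁
  have k₂ : ∫ r in a..(2 * a), f r = ∫ r in (0 : ℝ)..a, g₂ r := by
    have h : ∫ r in (0 : ℝ)..a, f (2 * a - r) = ∫ r in (0 : ℝ)..a, g₂ r := by
      apply intervalIntegral.integral_congr_uIoo
      rw [uIoo_of_le ha.le]; exact e₂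
    rw [← h, intervalIntegral.integral_comp_sub_left]
    congr 1 <;> ring
  have h2a : (0 : ℝ) ≤ 2 * a := by linarith
  constructor
  · rw [← intervalIntegrable_iff_integrableOn_Ioo_of_le h2a]
    exact j₁.trans j₂
  · rw [← integral_Ioc_eq_integral_Ioo, ← intervalIntegral.integral_of_le h2a,
      ← intervalIntegral.integral_add_adjacent_intervals j₁ j₂, k₁, k₂,
      intervalIntegral.integral_add i₁ i₂]

lemma tent_left {a b r : ℝ} (hr : r ∈ Ioo 0 a) : tent a b r = b / a * r := by
  simp [tent, hr.2.le]

lemma tent_right {a b r : ℝ} (hr : r ∈ Ioo 0 a) : tent a b (2 * a - r) = b / a * r := by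
  have : ¬ (2 * a - r ≤ a) := by have := hr.2; linarith
  simp [tent, this]

lemma deriv_tent_left {a b r : ℝ} (hr : r ∈ Ioo 0 a) : deriv (tent a b) r = b / a := by
  have h : tent a b =ᶠ[nhds r] fun s => b / a * s := by
    filter_upwards [Ioo_mem_nhds hr.1 hr.2] with s hs using tent_left hs
  rw [h.deriv_eq]
  simp

lemma deriv_tent_right {a b r : ℝ} (hr : r ∈ Ioo 0 a) :
    deriv (tent a b) (2 * a - r) = - (b / a) := by
  have h : tent a b =ᶠ[nhds (2 * a - r)] fun s => b / a * (2 * a - s) := by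
    filter_upwards [Ioo_mem_nhds (show a < 2 * a - r by linarith [hr.2])
      (show 2 * a - r < 2 * a by linarith [hr.1])] with s hs
    have := tent_right (b := b) (show 2 * a - s ∈ Ioo 0 a from
      ⟨by linarith [hs.2], by linarith [hs.1]⟩)
    simpa using this
  rw [h.deriv_eq]
  have : HasDerivAt (fun s : ℝ => b / a * (2 * a - s)) (b / a * (0 - 1)) (2 * a - r) :=
    ((hasDerivAt_const _ _).sub (hasDerivAt_id _)).const_mul _
  rw [this.deriv]; ring

lemma contLog {α : ℝ} (hα : 0 < α) (k : ℝ) :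
    Continuous fun r : ℝ => Real.log (1 + α * (k * r) ^ 2) := by
  apply Continuous.log (by fun_prop)
  intro r; positivity

lemma contDiv {a : ℝ} (ha : 0 < a) :
    ContinuousOn (fun r : ℝ => (2 * a - r)⁻¹) (Icc 0 a) := by
  apply ContinuousOn.inv₀ (by fun_prop)
  intro r hr
  have := hr.2
  linarith

lemma tent_lip {a b : ℝ} (ha : 0 < a) (s : Set ℝ) :
    ∃ K : NNReal, LipschitzOnWith K (tent a b) s := by
  have e : tent a b = fun r => b / a * (a - |r - a|) := by
    funext r
    unfold tent
    split_ifs with h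
    · rw [abs_of_nonpos (by linarith)]; ring
    · rw [abs_of_nonneg (by linarith)]; ring
  refine ⟨‖b / a‖₊, LipschitzWith.lipschitzOnWith ?_⟩
  rw [e]
  apply LipschitzWith.of_dist_le_mul
  intro x y
  rw [Real.dist_eq, Real.dist_eq, ← mul_sub, abs_mul]
  simp only [coe_nnnorm, Real.norm_eq_abs]
  refine mul_le_mul_of_nonneg_left ?_ (abs_nonneg _)
  have := abs_abs_sub_abs_le (y - a) (x - a)
  have e1 : a - |x - a| - (a - |y - a|) = |y - a| - |x - a| := by ring
  rw [e1]
  have e2 : |(y - a) - (x - a)| = |x - y| := by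
    rw [abs_sub_comm]; congr 1; ring
  rw [← e2]
  exact this

lemma tent_adm {α a : ℝ} (hα : 0 < α) (ha : 0 < a) (b : ℝ) : Admissible α (2 * a) (tent a b) := by
  refine ⟨tent_lip ha _, ?_, ?_, ?_⟩
  · simp [tent, ha.le]
  · have : ¬ (2 * a ≤ a) := by linarith
    simp [tent, this]
  · unfold FiniteEnergy
    refine (fold_integral ha
      (g₁ := fun r => r * (b / a) ^ 2 + (b / a) ^ 2 * r + r * Real.log (1 + α * (b / a * r) ^ 2))
      (g₂ := fun r => (2 * a - r) * (b / a) ^ 2 + (b / a * r) ^ 2 * (2 * a - r)⁻¹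
        + (2 * a - r) * Real.log (1 + α * (b / a * r) ^ 2)) ?_ ?_ ?_ ?_).1
    · have := contLog hα (b / a)
      fun_prop
    · have := contLog hα (b / a)
      have := contDiv ha
      fun_prop
    · intro r hr
      rw [deriv_tent_left hr, tent_left hr]
      have := hr.1.ne'
      congr 2
      rw [mul_pow, pow_two r]
      rw [← mul_assoc, mul_div_cancel_right₀ _ this]
    · intro r hr
      rw [deriv_tent_right hr, tent_right hr]
      simp only [neg_sq, div_eq_mul_inv]

lemma tent_flux {a : ℝ} (ha : 0 < a) (b : ℝ) :
    fluxQ (2 * a) (tent a b) = 2 * Real.pi * (2 / 3 * a ^ 2 * b ^ 2) := by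
  unfold fluxQ
  congr 1
  rw [(fold_integral ha
      (g₁ := fun r => r * (b / a * r) ^ 2)
      (g₂ := fun r => (2 * a - r) * (b / a * r) ^ 2) ?_ ?_ ?_ ?_).2]
  · have : ∀ r : ℝ, r * (b / a * r) ^ 2 + (2 * a - r) * (b / a * r) ^ 2
      = 2 * a * (b / a) ^ 2 * r ^ 2 := fun r => by ring
    simp only [this, intervalIntegral.integral_const_mul, integral_pow]
    field_simp
    norm_num
    ring
  · fun_prop
  · fun_prop
  · intro r hr
    rw [tent_left hr]
  · intro r hr
    rw [tent_right hr]

lemma tent_act {α a b : ℝ} (hα : 0 < α) (ha : 0 < a) (hb : 0 < b) (n : ℤ) :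
    actI0 α n (2 * a) (tent a b) = b ^ 2 * (1 + (n : ℝ) ^ 2 * (2 * Real.log 2 - 1))
      - 2 / 3 * α⁻¹ * a ^ 2 * b ^ 2 + 2 * (α ^ 2)⁻¹ * a ^ 2 * (Real.log (1 + α * b ^ 2) - 2 +
        2 / (Real.sqrt α * b) * Real.arctan (Real.sqrt α * b)) := by
  unfold actI0
  rw [(fold_integral ha
      (g₁ := fun r => r * (b / a) ^ 2 + (n : ℝ) ^ 2 * ((b / a) ^ 2 * r)
        - 2 * α⁻¹ * r * (b / a * r) ^ 2
        + 2 * (α ^ 2)⁻¹ * r * Real.log (1 + α * (b / a * r) ^ 2))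
      (g₂ := fun r => (2 * a - r) * (b / a) ^ 2 + (n : ℝ) ^ 2 * (2 * a - r)⁻¹ * (b / a * r) ^ 2
        - 2 * α⁻¹ * (2 * a - r) * (b / a * r) ^ 2
        + 2 * (α ^ 2)⁻¹ * (2 * a - r) * Real.log (1 + α * (b / a * r) ^ 2)) ?_ ?_ ?_ ?_).2]
  · set k := b / a with hk
    have hk0 : 0 < k := by positivity
    have hbk : b = k * a := by rw [hk]; field_simp
    set s := Real.sqrt α with hs
    have hs0 : 0 < s := Real.sqrt_pos.mpr hα
    have hs2 : α = s ^ 2 := (Real.sq_sqrt hα.le).symm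
    set F : ℝ → ℝ := fun r => 2 * a * k ^ 2 * r
      + (n : ℝ) ^ 2 * k ^ 2 * (-2 * a * r - 4 * a ^ 2 * Real.log (2 * a - r))
      - 4 * a * k ^ 2 / (3 * α) * r ^ 3
      + 4 * a * (α ^ 2)⁻¹ * (r * Real.log (1 + α * (k * r) ^ 2) - 2 * r
        + 2 / (s * k) * Real.arctan (s * k * r)) with hF
    rw [intervalIntegral.integral_eq_sub_of_hasDerivAt (f := F)]
    · simp only [hF]
      have h1 : 2 * a - a = a := by ring
      have h2 : Real.log (2 * a - 0) = Real.log 2 + Real.log a := by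
        rw [sub_zero, Real.log_mul (by norm_num) ha.ne']
      rw [h1, h2, hbk]
      simp only [mul_zero, Real.arctan_zero]
      rw [← mul_assoc s k a]
      field_simp
      ring
    · intro r hr
      rw [uIcc_of_le ha.le] at hr
      have h0 : 2 * a - r ≠ 0 := by have := hr.2; linarith
      have hp : 1 + α * (k * r) ^ 2 ≠ 0 := by positivity
      have hp' : 1 + (s * k * r) ^ 2 ≠ 0 := by positivity
      have d1 : HasDerivAt (fun r : ℝ => Real.log (2 * a - r)) (-1 / (2 * a - r)) r := by
        apply HasDerivAt.log _ h0
        simpa using (hasDerivAt_id r).const_sub (2 * a)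
      have d2 : HasDerivAt (fun r : ℝ => Real.log (1 + α * (k * r) ^ 2))
          (α * (2 * (k * r) * k) / (1 + α * (k * r) ^ 2)) r := by
        refine HasDerivAt.log (f := fun r : ℝ => 1 + α * (k * r) ^ 2) ?_ hp
        have := ((((hasDerivAt_id r).const_mul k).pow 2).const_mul α).const_add 1
        simpa using this
      have d3 : HasDerivAt (fun r : ℝ => Real.arctan (s * k * r))
          (1 / (1 + (s * k * r) ^ 2) * (s * k)) r := by
        apply HasDerivAt.arctan
        simpa using (hasDerivAt_id r).const_mul (s * k)
      have D := ((((hasDerivAt_id r).const_mul (2 * a * k ^ 2)).add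
        ((((hasDerivAt_id r).const_mul (-2 * a)).sub
          (d1.const_mul (4 * a ^ 2))).const_mul ((n : ℝ) ^ 2 * k ^ 2))).sub
        ((hasDerivAt_pow 3 r).const_mul (4 * a * k ^ 2 / (3 * α)))).add
        (((((hasDerivAt_id r).mul d2).sub ((hasDerivAt_id r).const_mul 2)).add
          (d3.const_mul (2 / (s * k)))).const_mul (4 * a * (α ^ 2)⁻¹))
      refine HasDerivAt.congr_deriv D ?_
      have e : (s * k * r) ^ 2 = α * (k * r) ^ 2 := by rw [hs2]; ring
      rw [e]
      simp only [id]
      generalize Real.log (1 + α * (k * r) ^ 2) = L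
      field_simp
      push_cast
      ring
    · apply ContinuousOn.intervalIntegrable
      rw [uIcc_of_le ha.le]
      have := contLog hα k
      have := contDiv ha
      fun_prop
  · have := contLog hα (b / a)
    fun_prop
  · have := contLog hα (b / a)
    have := contDiv ha
    fun_prop
  · intro r hr
    rw [deriv_tent_left hr, tent_left hr]
    have := hr.1.ne'
    congr 3
    field_simp
  · intro r hr
    rw [deriv_tent_right hr, tent_right hr]
    simp only [neg_sq, div_eq_mul_inv]

lemma vortex_energy {α : ℝ} (hα : 0 < α) {n : ℤ} {κ R : ℝ} (hR : 0 < R) {u : ℝ → ℝ}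
    (hu : IsVortexSol α n κ R u) (hE : FiniteEnergy α R u) :
    -(κ * ∫ r in Ioo (0 : ℝ) R, r * (u r) ^ 2) ≤ actI0 α n R u := by
  obtain ⟨hc, hd, h0, hRR, hode⟩ := hu
  have hpos : ∀ x : ℝ, 0 < 1 + α * x ^ 2 := fun x => by positivity
  have hlog : ∀ x : ℝ, 0 ≤ Real.log (1 + α * x ^ 2) := fun x =>
    Real.log_nonneg (by nlinarith [mul_nonneg hα.le (sq_nonneg x)])
  have cI : ∀ {f : ℝ → ℝ}, ContinuousOn f (Icc 0 R) → IntegrableOn f (Ioo 0 R) := fun h =>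
    (h.integrableOn_compact isCompact_Icc).mono_set Ioo_subset_Icc_self
  have cO := hc.mono Ioo_subset_Icc_self
  have mO : AEStronglyMeasurable u (volume.restrict (Ioo 0 R)) :=
    cO.aestronglyMeasurable measurableSet_Ioo
  have cLog : ContinuousOn (fun r => r * Real.log (1 + α * (u r) ^ 2)) (Icc 0 R) := by
    apply ContinuousOn.mul continuousOn_id
    apply ContinuousOn.log (by fun_prop)
    intro x _; exact (hpos _).ne'
  have iB : IntegrableOn (fun r => r * (u r) ^ 2) (Ioo 0 R) := cI (by fun_prop)
  have iL : IntegrableOn (fun r => r * Real.log (1 + α * (u r) ^ 2)) (Ioo 0 R) := cI cLog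
  have iQ : IntegrableOn (fun r => r * (u r) ^ 4 / (1 + α * (u r) ^ 2)) (Ioo 0 R) := by
    apply cI
    apply ContinuousOn.div (by fun_prop) (by fun_prop)
    intro x _; exact (hpos _).ne'
  have mP : AEStronglyMeasurable (fun r => r * (deriv u r) ^ 2) (volume.restrict (Ioo 0 R)) :=
    (measurable_id.mul ((measurable_deriv u).pow_const 2)).aestronglyMeasurable
  have mH : AEStronglyMeasurable (fun r => (u r) ^ 2 / r) (volume.restrict (Ioo 0 R)) :=
    (ContinuousOn.div (by fun_prop) continuousOn_id
      (fun r hr => hr.1.ne')).aestronglyMeasurable measurableSet_Ioo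
  have iP : IntegrableOn (fun r => r * (deriv u r) ^ 2) (Ioo 0 R) := by
    refine Integrable.mono' hE mP ?_
    filter_upwards [ae_restrict_mem measurableSet_Ioo] with r hr
    have h1 : 0 ≤ r * (deriv u r) ^ 2 := mul_nonneg hr.1.le (sq_nonneg _)
    have h2 : 0 ≤ (u r) ^ 2 / r := div_nonneg (sq_nonneg _) hr.1.le
    have h3 := mul_nonneg hr.1.le (hlog (u r))
    rw [Real.norm_eq_abs, abs_of_nonneg h1]
    linarith
  have iH : IntegrableOn (fun r => (u r) ^ 2 / r) (Ioo 0 R) := by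
    refine Integrable.mono' hE mH ?_
    filter_upwards [ae_restrict_mem measurableSet_Ioo] with r hr
    have h1 : 0 ≤ r * (deriv u r) ^ 2 := mul_nonneg hr.1.le (sq_nonneg _)
    have h2 : 0 ≤ (u r) ^ 2 / r := div_nonneg (sq_nonneg _) hr.1.le
    have h3 := mul_nonneg hr.1.le (hlog (u r))
    rw [Real.norm_eq_abs, abs_of_nonneg h2]
    linarith
  -- the flux function and its derivative
  set F : ℝ → ℝ := fun r => u r * (r * deriv u r) with hF
  set w : ℝ → ℝ := fun r => (n : ℝ) ^ 2 / r * u r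
      - 2 * r * (u r) ^ 3 / (1 + α * (u r) ^ 2) + 2 * κ * r * u r with hw
  set D : ℝ → ℝ := fun r => r * (deriv u r) ^ 2 + (n : ℝ) ^ 2 * ((u r) ^ 2 / r)
      - 2 * (r * (u r) ^ 4 / (1 + α * (u r) ^ 2)) + 2 * κ * (r * (u r) ^ 2) with hD
  have dp : ∀ r ∈ Ioo 0 R, HasDerivAt (fun s => s * deriv u s) (w r) r := by
    intro r hr
    have h1 : DifferentiableAt ℝ (fun s => s * deriv u s) r :=
      differentiableAt_id.mul (hd r hr).2
    refine h1.hasDerivAt.congr_deriv ?_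
    have := hode r hr
    simp only [hw]
    linarith
  have dF : ∀ r ∈ Ioo 0 R, HasDerivAt F (D r) r := by
    intro r hr
    refine ((hd r hr).1.hasDerivAt.mul (dp r hr)).congr_deriv ?_
    have := hr.1.ne'
    have := (hpos (u r)).ne'
    simp only [hw, hD]
    field_simp
    ring
  have iD : IntegrableOn D (Ioo 0 R) :=
    ((iP.add (iH.const_mul _)).sub (iQ.const_mul _)).add (iB.const_mul _)
  have iD' : IntervalIntegrable D volume 0 R := by
    rwa [intervalIntegrable_iff_integrableOn_Ioo_of_le hR.le]
  -- limit at `R`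
  have tR : Tendsto F (nhdsWithin R (Iio R)) (nhds 0) := by
    have cw : ContinuousOn w (Icc (R / 2) R) := by
      have hc' : ContinuousOn u (Icc (R / 2) R) :=
        hc.mono (Icc_subset_Icc_left (by linarith))
      have c1 : ContinuousOn (fun r : ℝ => (n : ℝ) ^ 2 / r) (Icc (R / 2) R) := by
        apply ContinuousOn.div continuousOn_const continuousOn_id
        intro r hr
        have : 0 < r := by have := hr.1; linarith
        exact this.ne'
      have c2 : ContinuousOn (fun r => 2 * r * (u r) ^ 3 / (1 + α * (u r) ^ 2))
          (Icc (R / 2) R) := by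
        apply ContinuousOn.div (by fun_prop) (by fun_prop)
        intro x _; exact (hpos _).ne'
      simp only [hw]
      fun_prop
    obtain ⟨C, hC⟩ := isCompact_Icc.exists_bound_of_continuousOn cw
    have hbd : ∀ r ∈ Ico (R / 2) R,
        ‖r * deriv u r‖ ≤ ‖R / 2 * deriv u (R / 2)‖ + C * R := by
      intro r hr
      have hC0 : 0 ≤ C := (norm_nonneg _).trans (hC r ⟨hr.1, hr.2.le⟩)
      have := Convex.norm_image_sub_le_of_norm_hasDerivWithin_le
        (f := fun s => s * deriv u s) (f' := w) (s := Ico (R / 2) R) (C := C)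
        (x := R / 2) (y := r)
        (fun x hx => (dp x ⟨by linarith [hx.1], hx.2⟩).hasDerivWithinAt)
        (fun x hx => hC x ⟨hx.1, hx.2.le⟩) (convex_Ico _ _)
        ⟨le_rfl, by linarith⟩ hr
      have h2 : ‖r - R / 2‖ ≤ R := by
        rw [Real.norm_eq_abs, abs_of_nonneg (by linarith [hr.1])]
        linarith [hr.2]
      have h3 := norm_sub_norm_le (r * deriv u r) (R / 2 * deriv u (R / 2))
      have h4 := mul_le_mul_of_nonneg_left h2 hC0
      linarith
    have tu : Tendsto u (nhdsWithin R (Iio R)) (nhds 0) := by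
      have h1 := hc R ⟨hR.le, le_rfl⟩
      have h2 : Tendsto u (nhdsWithin R (Icc 0 R)) (nhds 0) := by
        have h3 : Tendsto u (nhdsWithin R (Icc 0 R)) (nhds (u R)) := h1
        rwa [hRR] at h3
      refine h2.mono_left ?_
      rw [← nhdsWithin_Ioo_eq_nhdsLT hR]
      exact nhdsWithin_mono _ Ioo_subset_Icc_self
    have := bdd_le_mul_tendsto_zero' (f := fun r => r * deriv u r) (g := u)
      (l := nhdsWithin R (Iio R)) (‖R / 2 * deriv u (R / 2)‖ + C * R) ?_ tu
    · refine this.congr fun r => ?_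
      simp only [hF]; ring
    · filter_upwards [Ioo_mem_nhdsLT (show R / 2 < R by linarith)] with r hr
      exact hbd r ⟨hr.1.le, hr.2⟩
  -- limit at `0`
  obtain ⟨L, tL⟩ : ∃ L, Tendsto F (nhdsWithin 0 (Ioi 0)) (nhds L) := by
    have hm : R / 2 ∈ Ioo 0 R := ⟨by linarith, by linarith⟩
    have hc0 := intervalIntegral.continuousOn_primitive_interval' iD' (a := R / 2)
      (by rw [uIcc_of_le hR.le]; exact Ioo_subset_Icc_self hm)
    rw [uIcc_of_le hR.le] at hc0
    have h1 := (hc0 0 ⟨le_rfl, hR.le⟩).tendsto.mono_left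
      (nhdsWithin_mono _ (Ioo_subset_Icc_self))
    rw [nhdsWithin_Ioo_eq_nhdsGT hR] at h1
    refine ⟨_, (h1.const_add (F (R / 2))).congr' ?_⟩
    filter_upwards [Ioo_mem_nhdsGT hR] with r hr
    have hsub : uIcc (R / 2) r ⊆ Ioo 0 R := by
      intro x hx
      exact (ordConnected_Ioo.uIcc_subset hm hr) hx
    have := intervalIntegral.integral_eq_sub_of_hasDerivAt (f := F) (f' := D)
      (a := R / 2) (b := r) (fun x hx => dF x (hsub hx)) ?_
    · rw [this]; ring
    · rw [intervalIntegrable_iff]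
      exact iD.mono_set (uIoc_subset_uIcc.trans hsub)
  have hL : L = 0 := by
    by_contra hL
    have hev : ∀ᶠ r in nhdsWithin 0 (Ioi 0), |L| / 2 < |F r| :=
      tL.abs.eventually_const_lt (by have := abs_pos.mpr hL; linarith)
    obtain ⟨e, he, hsub⟩ := mem_nhdsGT_iff_exists_Ioo_subset.mp
      (hev.and (Ioo_mem_nhdsGT hR))
    have he0 : (0 : ℝ) < e := he
    have hi : IntervalIntegrable (fun x : ℝ => x⁻¹) volume 0 e := by
      rw [intervalIntegrable_iff_integrableOn_Ioo_of_le he0.le]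
      have hsubR : Ioo 0 e ⊆ Ioo 0 R := fun r hr => (hsub hr).2
      have iS : IntegrableOn (fun r => (1 / |L|) * (r * (deriv u r) ^ 2 + (u r) ^ 2 / r))
          (Ioo 0 e) := IntegrableOn.mono_set ((iP.add iH).const_mul _) hsubR
      refine Integrable.mono' iS measurable_inv.aestronglyMeasurable ?_
      filter_upwards [ae_restrict_mem measurableSet_Ioo] with r hr
      have h1 : |L| / 2 < |F r| := (hsub hr).1
      have hLp := abs_pos.mpr hL
      rw [Real.norm_eq_abs, abs_of_pos (inv_pos.mpr hr.1)]
      have key : |F r| ≤ r * (r * (deriv u r) ^ 2 + (u r) ^ 2 / r) / 2 := by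
        have e1 : r * (r * (deriv u r) ^ 2 + (u r) ^ 2 / r)
            = (r * deriv u r) ^ 2 + (u r) ^ 2 := by
          have := hr.1.ne'
          field_simp
        rw [e1]
        simp only [hF]
        rw [abs_le]
        constructor <;> nlinarith [sq_nonneg (u r - r * deriv u r),
          sq_nonneg (u r + r * deriv u r)]
      rw [inv_eq_one_div, div_mul_eq_mul_div, one_mul, div_le_div_iff₀ hr.1 hLp]
      nlinarith
    rw [intervalIntegrable_inv_iff] at hi
    rcases hi with h | h
    · exact he0.ne h
    · exact h left_mem_uIcc
  have hint : ∫ r in Ioo 0 R, D r = 0 := by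
    rw [← integral_Ioc_eq_integral_Ioo, ← intervalIntegral.integral_of_le hR.le,
      intervalIntegral.integral_eq_sub_of_hasDerivAt_of_tendsto hR dF iD' tL tR, hL, sub_zero]
  have hmono : ∫ r in Ioo 0 R, (D r - 2 * κ * (r * (u r) ^ 2)) ≤ ∫ r in Ioo (0 : ℝ) R,
    (r * (deriv u r) ^ 2 + ((n : ℝ) ^ 2 / r) * (u r) ^ 2
      - 2 * α⁻¹ * r * (u r) ^ 2 + 2 * (α ^ 2)⁻¹ * r * Real.log (1 + α * (u r) ^ 2)) := by
    refine setIntegral_mono_on (iD.sub (iB.const_mul _)) ?_ measurableSet_Ioo ?_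
    · have := ((iP.add (iH.const_mul ((n : ℝ) ^ 2))).sub (iB.const_mul (2 * α⁻¹))).add
        (iL.const_mul (2 * (α ^ 2)⁻¹))
      refine this.congr (ae_of_all _ fun r => ?_)
      simp only [Pi.add_apply, Pi.sub_apply]
      ring
    · intro r hr
      have hp := hpos (u r)
      have h1 := Real.one_sub_inv_le_log_of_pos hp
      have h2 : 0 ≤ 2 * (α ^ 2)⁻¹ * r := by have := hr.1; positivity
      have h3 := mul_le_mul_of_nonneg_left h1 h2
      have h4 : 2 * (α ^ 2)⁻¹ * r * (1 - (1 + α * (u r) ^ 2)⁻¹)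
          = 2 * α⁻¹ * r * (u r) ^ 2 - 2 * (r * (u r) ^ 4 / (1 + α * (u r) ^ 2)) := by
        have := hp.ne'
        field_simp
        ring
      have h5 : (n : ℝ) ^ 2 / r * (u r) ^ 2 = (n : ℝ) ^ 2 * ((u r) ^ 2 / r) := by ring
      simp only [hD]
      rw [h5]
      linarith
  rw [integral_sub iD (iB.const_mul _), hint, integral_const_mul] at hmono
  unfold actI0
  linarith

/-- lower bound on the propagation constant of a constrained minimizer. -/
theorem stmt7 (α : ℝ) (hα : 0 < α) (n : ℤ) (hn : 1 ≤ |n|) (κ R : ℝ) (hR : 0 < R)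
    (Q₀ : ℝ) (hQ₀ : 0 < Q₀) (u : ℝ → ℝ)
    (hu : IsVortexSol α n κ R u) (hE : FiniteEnergy α R u)
    (hflux : fluxQ R u = Q₀)
    (hmin : ∀ v : ℝ → ℝ, Admissible α R v → fluxQ R v = Q₀ → actI0 α n R u ≤ actI0 α n R v) :
    κ ≥ α⁻¹ - (6 / R ^ 2) * (1 + (n : ℝ) ^ 2 * (2 * Real.log 2 - 1))
      - (Real.pi * R ^ 2 / (α ^ 2 * Q₀)) *
        (Real.log (1 + 3 * α * Q₀ / (Real.pi * R ^ 2)) - 2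
          + Real.sqrt (4 * Real.pi * R ^ 2 / (3 * α * Q₀)) *
            Real.arctan (Real.sqrt (3 * α * Q₀ / (Real.pi * R ^ 2)))) := by
  have hpi := Real.pi_pos
  set a := R / 2 with ha_def
  have hRa : R = 2 * a := by rw [ha_def]; ring
  have ha : 0 < a := by positivity
  set b := Real.sqrt (3 * Q₀ / (Real.pi * R ^ 2)) with hb_def
  have hb : 0 < b := Real.sqrt_pos.mpr (by positivity)
  have hb2 : b ^ 2 = 3 * Q₀ / (Real.pi * R ^ 2) := Real.sq_sqrt (by positivity)
  have hQ : Q₀ = Real.pi * R ^ 2 * b ^ 2 / 3 := by rw [hb2]; field_simp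
  have h1 := vortex_energy hα hR hu hE
  have hfl : fluxQ R (tent a b) = Q₀ := by
    rw [hRa, tent_flux ha b, hQ, hRa]; ring
  have hadm : Admissible α R (tent a b) := by rw [hRa]; exact tent_adm hα ha b
  have h2 := hmin _ hadm hfl
  have hact := tent_act hα ha hb n
  rw [← hRa] at hact
  have hB : (∫ r in Ioo (0 : ℝ) R, r * (u r) ^ 2) = Q₀ / (2 * Real.pi) := by
    rw [← hflux]; unfold fluxQ; field_simp
  rw [hB] at h1
  have h3 := h1.trans h2
  rw [hact] at h3
  have e1 : 3 * α * Q₀ / (Real.pi * R ^ 2) = α * b ^ 2 := by rw [hb2]; ring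
  have e2 : Real.sqrt (α * b ^ 2) = Real.sqrt α * b := by
    rw [Real.sqrt_mul hα.le, Real.sqrt_sq hb.le]
  have hs0 : 0 < Real.sqrt α := Real.sqrt_pos.mpr hα
  have hs2 : Real.sqrt α ^ 2 = α := Real.sq_sqrt hα.le
  have e3 : Real.sqrt (4 * Real.pi * R ^ 2 / (3 * α * Q₀)) = 2 / (Real.sqrt α * b) := by
    have : 4 * Real.pi * R ^ 2 / (3 * α * Q₀) = (2 / (Real.sqrt α * b)) ^ 2 := by
      rw [div_pow, mul_pow, hs2, hQ]
      field_simp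
      norm_num
    rw [this, Real.sqrt_sq (by positivity)]
  rw [e1, e2, e3]
  generalize Real.log (1 + α * b ^ 2) - 2 +
        2 / (Real.sqrt α * b) * Real.arctan (Real.sqrt α * b) = T at h3 ⊢
  generalize 1 + (n : ℝ) ^ 2 * (2 * Real.log 2 - 1) = N at h3 ⊢
  have h4 : 0 ≤ (2 * Real.pi / Q₀) * (b ^ 2 * N - 2 / 3 * α⁻¹ * a ^ 2 * b ^ 2
      + 2 * (α ^ 2)⁻¹ * a ^ 2 * T + κ * (Q₀ / (2 * Real.pi))) :=
    mul_nonneg (by positivity) (by linarith)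
  have e5 : (2 * Real.pi / Q₀) * (b ^ 2 * N - 2 / 3 * α⁻¹ * a ^ 2 * b ^ 2
      + 2 * (α ^ 2)⁻¹ * a ^ 2 * T + κ * (Q₀ / (2 * Real.pi))) =
      κ - (α⁻¹ - 6 / R ^ 2 * N - Real.pi * R ^ 2 / (α ^ 2 * Q₀) * T) := by
    rw [hQ, hRa]
    field_simp
    ring
  linarith
end

section
/- Let u be a classical solution of the n-vortex equation with κ > 0, and suppose R₁ ∈ (0,R) is such that u(r)²/(1 + α u(r)²) ≤ κ/2 for all r ∈ [R₁, R]. Then u(r)² ≤ u(R₁)² · exp( −√(2κ) (r − R₁) ) for all r ∈ [R₁, R]; in particular u(r)² ≤ C_κ exp(−√(2κ) r) on [R₁,R] with C_κ = u(R₁)² exp(√(2κ) R₁). -/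
open MeasureTheory Set Filter

/-- exponential decay estimate. -/
theorem stmt9 (α : ℝ) (hα : 0 < α) (n : ℤ) (hn : 1 ≤ |n|) (κ R : ℝ) (hκ : 0 < κ)
    (hR : 0 < R) (u : ℝ → ℝ) (hu : IsVortexSol α n κ R u)
    (R₁ : ℝ) (hR₁ : R₁ ∈ Ioo (0 : ℝ) R)
    (hsmall : ∀ r ∈ Icc R₁ R, (u r) ^ 2 / (1 + α * (u r) ^ 2) ≤ κ / 2) :
    (∀ r ∈ Icc R₁ R,
      (u r) ^ 2 ≤ (u R₁) ^ 2 * Real.exp (-(Real.sqrt (2 * κ)) * (r - R₁))) ∧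
    (∀ r ∈ Icc R₁ R,
      (u r) ^ 2 ≤ ((u R₁) ^ 2 * Real.exp (Real.sqrt (2 * κ) * R₁))
        * Real.exp (-(Real.sqrt (2 * κ)) * r)) := by
  obtain ⟨hc, hd, h0, hRR, heq⟩ := hu
  obtain ⟨hR1, hR1R⟩ := hR₁
  set σ := Real.sqrt (2 * κ) with hσ
  have hσ2 : σ ^ 2 = 2 * κ := Real.sq_sqrt (by positivity)
  have hσ0 : 0 ≤ σ := Real.sqrt_nonneg _
  have main : ∀ r ∈ Icc R₁ R, (u r) ^ 2 ≤ (u R₁) ^ 2 * Real.exp (-σ * (r - R₁)) := by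
    set φ : ℝ → ℝ := fun r => (u r) ^ 2 - (u R₁) ^ 2 * Real.exp (-σ * (r - R₁)) with hφ
    have hφc : ContinuousOn φ (Icc R₁ R) := by
      have : ContinuousOn u (Icc R₁ R) := hc.mono (Icc_subset_Icc_left hR1.le)
      exact (this.pow 2).sub (Continuous.continuousOn (by fun_prop))
    obtain ⟨c, hcm, hmax⟩ := isCompact_Icc.exists_isMaxOn (nonempty_Icc.2 hR1R.le) hφc
    suffices hle : φ c ≤ 0 by
      intro r hr
      have h1 : φ r ≤ φ c := hmax hr
      have h2 : φ r ≤ 0 := h1.trans hle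
      simpa [hφ] using h2
    by_contra hpos
    push Not at hpos
    have hc1 : R₁ < c := by
      refine lt_of_le_of_ne hcm.1 ?_
      rintro rfl
      simp [hφ] at hpos
    have hc2 : c < R := by
      refine lt_of_le_of_ne hcm.2 ?_
      rintro rfl
      simp only [hφ, hRR] at hpos
      have : 0 ≤ (u R₁) ^ 2 * Real.exp (-σ * (c - R₁)) := by positivity
      linarith
    have hc0 : 0 < c := hR1.trans hc1
    have hlm : IsLocalMax φ c := hmax.isLocalMax (Icc_mem_nhds hc1 hc2)
    have hE : ∀ r, HasDerivAt (fun r => Real.exp (-σ * (r - R₁)))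
        (Real.exp (-σ * (r - R₁)) * (-σ)) r := by
      intro r
      have : HasDerivAt (fun r => -σ * (r - R₁)) (-σ * 1) r :=
        ((hasDerivAt_id r).sub_const R₁).const_mul (-σ)
      simpa using this.exp
    have hφd : ∀ r ∈ Ioo (0 : ℝ) R, HasDerivAt φ
        (2 * u r * deriv u r - (u R₁) ^ 2 * (Real.exp (-σ * (r - R₁)) * (-σ))) r := by
      intro r hr
      have h1 := ((hd r hr).1.hasDerivAt.pow 2).sub ((hE r).const_mul ((u R₁) ^ 2))
      refine h1.congr_deriv ?_
      norm_num
    have hev : deriv φ =ᶠ[nhds c] fun r =>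
        2 * u r * deriv u r - (u R₁) ^ 2 * (Real.exp (-σ * (r - R₁)) * (-σ)) := by
      filter_upwards [Ioo_mem_nhds hc0 hc2] with r hr using (hφd r hr).deriv
    obtain ⟨hdu, hddu⟩ := hd c ⟨hc0, hc2⟩
    have hφdd : deriv (deriv φ) c = 2 * deriv u c * deriv u c + 2 * u c * deriv (deriv u) c
        - (u R₁) ^ 2 * (Real.exp (-σ * (c - R₁)) * (-σ) * (-σ)) := by
      rw [hev.deriv_eq]
      exact (((hdu.hasDerivAt.const_mul 2).mul hddu.hasDerivAt).sub
        (((hE c).mul_const (-σ)).const_mul ((u R₁) ^ 2))).deriv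
    have hφ0 : deriv φ c = 0 := hlm.deriv_eq_zero
    have hφ0' := hφ0
    rw [hev.eq_of_nhds] at hφ0'
    have hode := heq c ⟨hc0, hc2⟩
    have hdd : deriv (fun s => s * deriv u s) c = 1 * deriv u c + c * deriv (deriv u) c :=
      ((hasDerivAt_id c).mul hddu.hasDerivAt).deriv
    rw [hdd] at hode
    have hs := hsmall c hcm
    set E := (u R₁) ^ 2 * Real.exp (-σ * (c - R₁)) with hEdef
    have hE0 : 0 ≤ E := by positivity
    have hposE : 0 < (u c) ^ 2 - E := hpos
    set q := (u c) ^ 2 / (1 + α * (u c) ^ 2) with hq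
    have hode2 : c * deriv (deriv u) c
        = ((n : ℝ) ^ 2 / c + 2 * κ * c - 2 * c * q) * u c - deriv u c := by
      have : 2 * c * (u c) ^ 3 / (1 + α * (u c) ^ 2) = 2 * c * q * u c := by
        rw [hq]; ring
      rw [this] at hode
      linarith
    have hsec : 0 < deriv (deriv φ) c := by
      have h1 : c * deriv (deriv φ) c = 2 * c * (deriv u c) ^ 2
          + 2 * ((n : ℝ) ^ 2 / c) * (u c) ^ 2 + 4 * c * (κ / 2 - q) * (u c) ^ 2
          + 2 * κ * c * ((u c) ^ 2 - E) + σ * E := by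
        have e1 : 2 * u c * deriv u c = - (σ * E) := by rw [hEdef]; linarith
        have e2 : deriv (deriv φ) c = 2 * deriv u c * deriv u c
            + 2 * u c * deriv (deriv u) c - 2 * κ * E := by
          rw [hφdd, hEdef, ← hσ2]; ring
        rw [e2]
        linear_combination 2 * u c * hode2 - e1
      have h2 : 0 < c * deriv (deriv φ) c := by
        rw [h1]
        have : 0 ≤ κ / 2 - q := by linarith
        positivity
      exact pos_of_mul_pos_right h2 hc0.le
    have hlmin : IsLocalMin φ c :=
      isLocalMin_of_deriv_deriv_pos hsec hφ0 (hφd c ⟨hc0, hc2⟩).continuousAt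
    have hconst : φ =ᶠ[nhds c] fun _ => φ c := by
      filter_upwards [hlm, hlmin] with x h1 h2 using le_antisymm h1 h2
    have hz : deriv (deriv φ) c = 0 := by
      rw [hconst.deriv.deriv_eq]; simp
    linarith
  refine ⟨main, fun r hr => (main r hr).trans_eq ?_⟩
  rw [mul_assoc, ← Real.exp_add]
  ring_nf
end
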